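/- arXiv:1308.0531 — 7 statements merged into one kernel-verified Lean document; each statement's English description precedes it below -/
import Mathlib

section
/- Comparison principle on a convex region (nonlocal dispersal case). Assume f satisfies (H0). Let Ω ⊆ ℝ^N be a convex set, τ ∈ (0,∞], and let u¹, u² : [0,τ) × ℝ^N → ℝ be continuous and bounded functions such that for every x in the closure of Ω the map t ↦ uⁱ(t,x) is differentiable on (0,τ) (i = 1,2), and for all t ∈ (0,τ) and all x in the closure of Ω one has ∂_t u¹(t,x) ≤ ∫_{ℝ^N} κ(y−x) u¹(t,y) dy − u¹(t,x) + u¹(t,x) f(t,x,u¹(t,x)) and ∂_t u²(t,x) ≥ ∫_{ℝ^N} κ(y−x) u²(t,y) dy − u²(t,x) + u²(t,x) f(t,x,u²(t,x)). If u¹(t,x) ≤ u²(t,x) for all t ∈ [0,τ) and all x ∈ ℝ^N \ Ω, and u¹(0,x) ≤ u²(0,x) for all x in the closure of Ω, then u¹(t,x) ≤ u²(t,x) for all t ∈ [0,τ) and all x ∈ Ω. -/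
open MeasureTheory Set Filter RealInnerProductSpace

noncomputable section

abbrev Euc (N : ℕ) := EuclideanSpace ℝ (Fin N)

/-- Membership in `X`: bounded and uniformly continuous real functions on `ℝ^N`. -/
def MemX {N : ℕ} (u : Euc N → ℝ) : Prop :=
  UniformContinuous u ∧ ∃ C, ∀ x, |u x| ≤ C

/-- Hypotheses on the convolution kernel `κ`. -/
def KernelHyp {N : ℕ} (κ : Euc N → ℝ) : Prop :=
  Continuous κ ∧ (∀ z, 0 ≤ κ z) ∧ HasCompactSupport κ ∧ 0 < κ 0 ∧ (∫ z, κ z) = 1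

/-- Hypothesis (H0) on the nonlinearity `f`. -/
def SatH0 {N : ℕ} (T M₀ : ℝ) (f : ℝ → Euc N → ℝ → ℝ) : Prop :=
  (∀ t x u, f (t + T) x u = f t x u) ∧
  (∀ x : Euc N, ContDiff ℝ 1 (fun p : ℝ × ℝ => f p.1 x p.2)) ∧
  (∀ R : ℝ, 0 < R →
    (∃ C, ∀ t x u, |u| ≤ R →
      |f t x u| + |deriv (fun s => f s x u) t| + |deriv (fun v => f t x v) u| ≤ C) ∧
    UniformContinuousOn (fun p : ℝ × Euc N × ℝ => f p.1 p.2.1 p.2.2)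
      {p : ℝ × Euc N × ℝ | |p.2.2| ≤ R} ∧
    UniformContinuousOn (fun p : ℝ × Euc N × ℝ => deriv (fun s => f s p.2.1 p.2.2) p.1)
      {p : ℝ × Euc N × ℝ | |p.2.2| ≤ R} ∧
    UniformContinuousOn (fun p : ℝ × Euc N × ℝ => deriv (fun v => f p.1 p.2.1 v) p.2.2)
      {p : ℝ × Euc N × ℝ | |p.2.2| ≤ R}) ∧
  (∀ t x u, M₀ ≤ u → f t x u < 0) ∧
  (∀ a b : ℝ, 0 ≤ a → a ≤ b → ∃ c < (0:ℝ), ∀ t x u, a ≤ u → u ≤ b →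
    deriv (fun v => f t x v) u ≤ c)

/-- Right-hand side of the nonlocal dispersal KPP equation (E_g). -/
def RHS {N : ℕ} (κ : Euc N → ℝ) (g : ℝ → Euc N → ℝ → ℝ)
    (u : ℝ → Euc N → ℝ) (t : ℝ) (x : Euc N) : ℝ :=
  (∫ y, κ (y - x) * u t y) - u t x + u t x * g t x (u t x)

/-- A solution of (E_g) on the interval `I`. -/
def IsSol {N : ℕ} (κ : Euc N → ℝ) (g : ℝ → Euc N → ℝ → ℝ)
    (u : ℝ → Euc N → ℝ) (I : Set ℝ) : Prop :=
  ContinuousOn (fun p : ℝ × Euc N => u p.1 p.2) (I ×ˢ univ) ∧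
  (∀ t ∈ I, MemX (u t)) ∧
  (∀ J : Set ℝ, J ⊆ I → IsCompact J → ∃ C, ∀ t ∈ J, ∀ x, |u t x| ≤ C) ∧
  (∀ x : Euc N, ∀ t ∈ interior I, HasDerivAt (fun s => u s x) (RHS κ g u t x) t)

/-- A time periodic strictly positive solution of (E_g). -/
def PeriodicPosSol {N : ℕ} (κ : Euc N → ℝ) (g : ℝ → Euc N → ℝ → ℝ) (T : ℝ)
    (u : ℝ → Euc N → ℝ) : Prop :=
  IsSol κ g u univ ∧ (∀ t x, u (t + T) x = u t x) ∧ ∃ δ > 0, ∀ t x, δ ≤ u t x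

/-- The part metric between two strictly positive bounded functions. -/
def PartMetric {N : ℕ} (u v : Euc N → ℝ) : ℝ :=
  sInf (Real.log '' {α : ℝ | 1 ≤ α ∧ ∀ x, u x / α ≤ v x ∧ v x ≤ α * u x})

/-- Hypothesis (H1): `f` is asymptotically (in space) equal to the time and space
periodic nonlinearity `f₀`. -/
def SatH1 {N : ℕ} (T M₀ : ℝ) (p : Fin N → ℝ) (f f₀ : ℝ → Euc N → ℝ → ℝ) : Prop :=
  SatH0 T M₀ f₀ ∧ (∀ i, 0 < p i) ∧
  (∀ i t x u, f₀ t (x + p i • EuclideanSpace.single i (1:ℝ)) u = f₀ t x u) ∧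
  (∀ R : ℝ, 0 < R → ∀ ε : ℝ, 0 < ε → ∃ ρ : ℝ, ∀ t x u, ρ ≤ ‖x‖ → |u| ≤ R →
    |f t x u - f₀ t x u| ≤ ε)

/-- A time and space periodic positive solution of (E_g) (period `T` in time and
periods `pᵢ` in the spatial coordinate directions). -/
def PeriodicMediaSol {N : ℕ} (κ : Euc N → ℝ) (g : ℝ → Euc N → ℝ → ℝ) (T : ℝ)
    (p : Fin N → ℝ) (u : ℝ → Euc N → ℝ) : Prop :=
  IsSol κ g u univ ∧ (∀ t x, u (t + T) x = u t x) ∧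
  (∀ i t x, u t (x + p i • EuclideanSpace.single i (1:ℝ)) = u t x) ∧
  (∀ t x, 0 < u t x)

/-- The class `X⁺(ξ)` of front-like nonnegative initial data in the direction `ξ`. -/
def XplusXi {N : ℕ} (ξ : Euc N) (u : Euc N → ℝ) : Prop :=
  MemX u ∧ (∀ x, 0 ≤ u x) ∧
  (∃ m > 0, ∃ r : ℝ, ∀ x, ⟪x, ξ⟫ ≤ r → m ≤ u x) ∧
  (∃ r₀ : ℝ, ∀ x, r₀ ≤ ⟪x, ξ⟫ → u x = 0)


theorem aux_gron (v v' : ℝ → ℝ) (t L A ε : ℝ) (ht : 0 < t) (hA : 0 ≤ A) (hε : 0 < ε)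
    (hc : ContinuousOn v (Icc 0 t)) (h0 : v 0 ≤ 0)
    (hd : ∀ s ∈ Ioc 0 t, HasDerivAt v (v' s) s)
    (hb : ∀ s ∈ Ioc 0 t, 0 < v s → v' s ≤ A * Real.exp ((L + 2) * s) + L * v s) :
    v t ≤ (A / 2 + ε) * Real.exp ((L + 2) * t) := by
  set B : ℝ → ℝ := fun s => (A / 2 + ε) * Real.exp ((L + 2) * s) with hB
  have hBc : Continuous B := by rw [hB]; fun_prop
  have hBd : ∀ s, HasDerivAt B ((A / 2 + ε) * (Real.exp ((L + 2) * s) * (L + 2))) s := by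
    intro s
    have h1 : HasDerivAt (fun s : ℝ => (L + 2) * s) (L + 2) s := by
      simpa using (hasDerivAt_id s).const_mul (L + 2)
    exact h1.exp.const_mul _
  have hBpos : ∀ s, 0 < B s := fun s => by rw [hB]; positivity
  have hev : ∀ᶠ s in nhdsWithin 0 (Ioo 0 t), v s < B s := by
    have h1 : Tendsto v (nhdsWithin 0 (Ioo 0 t)) (nhds (v 0)) :=
      (hc 0 ⟨le_rfl, ht.le⟩).mono_left (nhdsWithin_mono _ Ioo_subset_Icc_self)
    have h2 : Tendsto B (nhdsWithin 0 (Ioo 0 t)) (nhds (B 0)) :=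
      hBc.continuousAt.mono_left nhdsWithin_le_nhds
    exact h1.eventually_lt h2 (h0.trans_lt (hBpos 0))
  have hne : (nhdsWithin (0:ℝ) (Ioo 0 t)).NeBot := by
    rw [nhdsWithin_Ioo_eq_nhdsGT ht]; infer_instance
  obtain ⟨δ, hδ, hδt⟩ := (hev.and self_mem_nhdsWithin).exists
  have key := image_le_of_deriv_right_lt_deriv_boundary' (f := v) (f' := v') (a := δ) (b := t)
    (B := B) (B' := fun s => (A / 2 + ε) * (Real.exp ((L + 2) * s) * (L + 2)))
    (hc.mono (Icc_subset_Icc hδt.1.le le_rfl))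
    (fun s hs => (hd s ⟨hδt.1.trans_le hs.1, hs.2.le⟩).hasDerivWithinAt) hδ.le
    hBc.continuousOn (fun s _ => (hBd s).hasDerivWithinAt)
    (fun s hs he => by
      have h1 := hb s ⟨hδt.1.trans_le hs.1, hs.2.le⟩ (he ▸ hBpos s)
      rw [he] at h1
      have h2 := Real.exp_pos ((L + 2) * s)
      have h3 := mul_pos hε h2
      simp only [hB] at h1
      nlinarith)
  exact key (right_mem_Icc.2 hδt.2.le)

theorem aux_lip {N : ℕ} {T M₀ : ℝ} {f : ℝ → Euc N → ℝ → ℝ} (hf : SatH0 T M₀ f)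
    (R : ℝ) (hR : 0 < R) : ∃ L, ∀ t x a b, |a| ≤ R → |b| ≤ R → b ≤ a →
      a * f t x a - b * f t x b ≤ L * (a - b) := by
  obtain ⟨-, hC1, hbd, -, -⟩ := hf
  obtain ⟨⟨C, hC⟩, -⟩ := hbd R hR
  refine ⟨C + R * C, fun t x a b ha hb hab => ?_⟩
  have hdiff : Differentiable ℝ (fun v => f t x v) := by
    have h := (hC1 x).differentiable (by norm_num)
    exact h.comp (f := fun v : ℝ => (t, v)) (by fun_prop)
  have h1 : ‖f t x a - f t x b‖ ≤ C * ‖a - b‖ := by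
    refine (convex_Icc (-R) R).norm_image_sub_le_of_norm_deriv_le (f := fun v => f t x v)
      (fun v _ => hdiff v) (fun v hv => ?_) (abs_le.1 hb) (abs_le.1 ha)
    have h := hC t x v (abs_le.2 hv)
    rw [Real.norm_eq_abs]
    have := abs_nonneg (f t x v)
    have := abs_nonneg (deriv (fun s => f s x v) t)
    linarith
  have h2 : |f t x a| ≤ C := by
    have h := hC t x a ha
    have := abs_nonneg (deriv (fun v => f t x v) a)
    have := abs_nonneg (deriv (fun s => f s x a) t)
    linarith
  rw [Real.norm_eq_abs, Real.norm_eq_abs, abs_of_nonneg (sub_nonneg.2 hab)] at h1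
  have e : a * f t x a - b * f t x b = (a - b) * f t x a + b * (f t x a - f t x b) := by ring
  have h3 : (a - b) * f t x a ≤ (a - b) * C :=
    mul_le_mul_of_nonneg_left ((le_abs_self _).trans h2) (sub_nonneg.2 hab)
  have h4 : b * (f t x a - f t x b) ≤ R * (C * (a - b)) := by
    refine (le_abs_self _).trans ?_
    rw [abs_mul]
    exact mul_le_mul hb h1 (abs_nonneg _) hR.le
  rw [e]; linarith

theorem aux_int {N : ℕ} {κ : Euc N → ℝ} (hκ : KernelHyp κ) (x : Euc N) (p q : Euc N → ℝ)
    (hp : Continuous p) (hq : Continuous q) (D : ℝ) (hD : ∀ y, p y - q y ≤ D) :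
    (∫ y, κ (y - x) * p y) - (∫ y, κ (y - x) * q y) ≤ D := by
  obtain ⟨hkc, hk0, hks, -, hk1⟩ := hκ
  have hks' : HasCompactSupport (fun y => κ (y - x)) := by
    simpa [Function.comp_def, sub_eq_add_neg] using
      hks.comp_homeomorph (Homeomorph.addRight (-x))
  have hkc' : Continuous (fun y => κ (y - x)) := by fun_prop
  have hi : ∀ p : Euc N → ℝ, Continuous p → Integrable (fun y => κ (y - x) * p y) :=
    fun p hp => (hkc'.mul hp).integrable_of_hasCompactSupport hks'.mul_right
  rw [← integral_sub (hi p hp) (hi q hq)]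
  have h1 : ∫ y, κ (y - x) * D = D := by
    rw [integral_mul_const, integral_sub_right_eq_self (fun y => κ y) x, hk1, one_mul]
  calc _ ≤ ∫ y, κ (y - x) * D := by
        refine integral_mono ((hi p hp).sub (hi q hq)) (hi _ continuous_const) (fun y => ?_)
        have := mul_le_mul_of_nonneg_left (hD y) (hk0 (y - x))
        simp only
        linarith
    _ = D := h1

/-- comparison principle on a convex region (nonlocal dispersal case). -/
theorem stmt0 {N : ℕ} (hN : 1 ≤ N) (T M₀ : ℝ) (hT : 0 < T) (hM₀ : 0 < M₀)
    (κ : Euc N → ℝ) (hκ : KernelHyp κ)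
    (f : ℝ → Euc N → ℝ → ℝ) (hf : SatH0 T M₀ f)
    (Ω : Set (Euc N)) (hΩ : Convex ℝ Ω)
    (I : Set ℝ) (hI : (∃ τ > 0, I = Set.Ico 0 τ) ∨ I = Set.Ici (0:ℝ))
    (u₁ u₂ : ℝ → Euc N → ℝ)
    (hc₁ : ContinuousOn (fun p : ℝ × Euc N => u₁ p.1 p.2) (I ×ˢ univ))
    (hc₂ : ContinuousOn (fun p : ℝ × Euc N => u₂ p.1 p.2) (I ×ˢ univ))
    (hb₁ : ∃ C, ∀ t ∈ I, ∀ x, |u₁ t x| ≤ C)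
    (hb₂ : ∃ C, ∀ t ∈ I, ∀ x, |u₂ t x| ≤ C)
    (hd₁ : ∀ x ∈ closure Ω, ∀ t ∈ interior I, DifferentiableAt ℝ (fun s => u₁ s x) t)
    (hd₂ : ∀ x ∈ closure Ω, ∀ t ∈ interior I, DifferentiableAt ℝ (fun s => u₂ s x) t)
    (hsub : ∀ t ∈ interior I, ∀ x ∈ closure Ω,
      deriv (fun s => u₁ s x) t ≤ RHS κ f u₁ t x)
    (hsup : ∀ t ∈ interior I, ∀ x ∈ closure Ω,
      RHS κ f u₂ t x ≤ deriv (fun s => u₂ s x) t)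
    (hout : ∀ t ∈ I, ∀ x, x ∉ Ω → u₁ t x ≤ u₂ t x)
    (hinit : ∀ x ∈ closure Ω, u₁ 0 x ≤ u₂ 0 x) :
    ∀ t ∈ I, ∀ x ∈ Ω, u₁ t x ≤ u₂ t x := by
  have h0I : (0:ℝ) ∈ I := by
    rcases hI with ⟨τ, hτ, rfl⟩ | rfl
    · exact ⟨le_rfl, hτ⟩
    · exact mem_Ici.2 le_rfl
  have hIcc : ∀ t ∈ I, Icc 0 t ⊆ I := by
    rcases hI with ⟨τ, hτ, rfl⟩ | rfl
    · exact fun t ht s hs => ⟨hs.1, hs.2.trans_lt ht.2⟩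
    · exact fun t ht s hs => hs.1
  have hInt : ∀ t ∈ I, Ioc 0 t ⊆ interior I := by
    rcases hI with ⟨τ, hτ, rfl⟩ | rfl
    · intro t ht s hs
      rw [interior_Ico]
      exact ⟨hs.1, hs.2.trans_lt ht.2⟩
    · intro t ht s hs
      rw [interior_Ici]
      exact hs.1
  have hnn : ∀ t ∈ I, 0 ≤ t := by
    rcases hI with ⟨τ, hτ, rfl⟩ | rfl
    · exact fun t ht => ht.1
    · exact fun t ht => ht
  obtain ⟨C₁, hC₁⟩ := hb₁
  obtain ⟨C₂, hC₂⟩ := hb₂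
  have hC₁0 : 0 ≤ C₁ := (abs_nonneg _).trans (hC₁ 0 h0I 0)
  have hC₂0 : 0 ≤ C₂ := (abs_nonneg _).trans (hC₂ 0 h0I 0)
  obtain ⟨L₀, hL₀⟩ := aux_lip hf (C₁ + C₂ + 1) (by linarith)
  set L := max L₀ 0 with hLdef
  have hL0 : 0 ≤ L := le_max_right _ _
  have hsx : ∀ u : ℝ → Euc N → ℝ, ContinuousOn (fun p : ℝ × Euc N => u p.1 p.2) (I ×ˢ univ) →
      ∀ t ∈ I, Continuous (u t) := by
    intro u hu t ht
    have : ContinuousOn (fun y : Euc N => u t y) univ :=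
      hu.comp (f := fun y : Euc N => (t, y)) (by fun_prop) (fun y _ => ⟨ht, mem_univ _⟩)
    exact continuousOn_univ.1 this
  have hst : ∀ u : ℝ → Euc N → ℝ, ContinuousOn (fun p : ℝ × Euc N => u p.1 p.2) (I ×ˢ univ) →
      ∀ x, ContinuousOn (fun s => u s x) I := by
    intro u hu x
    exact hu.comp (f := fun s : ℝ => (s, x)) (by fun_prop) (fun y hy => ⟨hy, mem_univ _⟩)
  have step : ∀ A, 0 ≤ A → (∀ t ∈ I, ∀ x, u₁ t x - u₂ t x ≤ A * Real.exp ((L + 2) * t)) →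
      (∀ t ∈ I, ∀ x, u₁ t x - u₂ t x ≤ A / 2 * Real.exp ((L + 2) * t)) := by
    intro A hA hyp t ht x
    by_cases hx : x ∈ Ω
    swap
    · have := hout t ht x hx
      have h2 : 0 ≤ A / 2 * Real.exp ((L + 2) * t) := by positivity
      linarith
    have hxc := subset_closure hx
    rcases (hnn t ht).eq_or_lt with h0 | h0
    · subst h0
      have := hinit x hxc
      have h2 : 0 ≤ A / 2 * Real.exp ((L + 2) * 0) := by positivity
      linarith
    have main : ∀ ε > 0, u₁ t x - u₂ t x ≤ (A / 2 + ε) * Real.exp ((L + 2) * t) := by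
      intro ε hε
      refine aux_gron (fun s => u₁ s x - u₂ s x)
        (fun s => deriv (fun s => u₁ s x) s - deriv (fun s => u₂ s x) s) t L A ε h0 hA hε
        (((hst u₁ hc₁ x).sub (hst u₂ hc₂ x)).mono (hIcc t ht)) ?_ ?_ ?_
      · have := hinit x hxc
        linarith
      · intro s hs
        exact (hd₁ x hxc s (hInt t ht hs)).hasDerivAt.sub (hd₂ x hxc s (hInt t ht hs)).hasDerivAt
      · intro s hs hpos
        have hsI : s ∈ I := interior_subset (hInt t ht hs)
        have e1 := hsub s (hInt t ht hs) x hxc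
        have e2 := hsup s (hInt t ht hs) x hxc
        have e3 := aux_int hκ x (u₁ s) (u₂ s) (hsx u₁ hc₁ s hsI) (hsx u₂ hc₂ s hsI) _ (hyp s hsI)
        have e4 := hL₀ s x (u₁ s x) (u₂ s x) ((hC₁ s hsI x).trans (by linarith))
          ((hC₂ s hsI x).trans (by linarith)) (by linarith)
        have e5 : L₀ * (u₁ s x - u₂ s x) ≤ L * (u₁ s x - u₂ s x) :=
          mul_le_mul_of_nonneg_right (le_max_left _ _) hpos.le
        unfold RHS at e1 e2
        linarith
    have hE := Real.exp_pos ((L + 2) * t)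
    refine le_of_forall_pos_le_add fun ε hε => ?_
    have := main (ε / Real.exp ((L + 2) * t)) (div_pos hε hE)
    rwa [add_mul, div_mul_cancel₀ _ hE.ne'] at this
  have iter : ∀ n : ℕ, ∀ t ∈ I, ∀ x,
      u₁ t x - u₂ t x ≤ (C₁ + C₂) / 2 ^ n * Real.exp ((L + 2) * t) := by
    intro n
    induction n with
    | zero =>
      intro t ht x
      have a1 := (abs_le.1 (hC₁ t ht x)).2
      have a2 := (abs_le.1 (hC₂ t ht x)).1
      have a3 : 1 ≤ Real.exp ((L + 2) * t) :=
        Real.one_le_exp (mul_nonneg (by linarith) (hnn t ht))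
      have a4 : (C₁ + C₂) * 1 ≤ (C₁ + C₂) * Real.exp ((L + 2) * t) :=
        mul_le_mul_of_nonneg_left a3 (by linarith)
      rw [pow_zero, div_one]
      linarith
    | succ n ih =>
      have := step _ (by positivity) ih
      rwa [div_div, ← pow_succ] at this
  intro t ht x _
  have hlim : Tendsto (fun n : ℕ => (C₁ + C₂) / 2 ^ n * Real.exp ((L + 2) * t)) atTop (nhds 0) := by
    have h1 : Tendsto (fun n : ℕ => ((1:ℝ) / 2) ^ n) atTop (nhds 0) :=
      tendsto_pow_atTop_nhds_zero_of_lt_one (by norm_num) (by norm_num)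
    have h2 := (h1.const_mul (C₁ + C₂)).mul_const (Real.exp ((L + 2) * t))
    simpa [div_eq_mul_inv] using h2
  have := ge_of_tendsto' hlim (fun n => iter n t ht x)
  linarith

end
end

section
/- Convergence of solutions on compact subsets (nonlocal dispersal case). Let fₙ and gₙ (n ∈ ℕ) each satisfy (H0) (with the same T and M₀), and suppose that for every R > 0, sup_n sup{ |fₙ(t,x,u)| + |gₙ(t,x,u)| + |∂_u fₙ(t,x,u)| : t ∈ ℝ, x ∈ ℝ^N, |u| ≤ R } < ∞. Fix τ > 0, u₀ ∈ X and u₀ₙ ∈ X with sup_n ‖u₀ₙ‖ < ∞. Let uₙ be a solution of (E_{fₙ}) on [0,τ] with uₙ(0,·) = u₀ₙ and vₙ a solution of (E_{gₙ}) on [0,τ] with vₙ(0,·) = u₀, and assume sup_n sup_{t∈[0,τ]} (‖uₙ(t,·)‖ + ‖vₙ(t,·)‖) < ∞. If u₀ₙ → u₀ as n → ∞ uniformly on every compact subset of ℝ^N, and fₙ − gₙ → 0 as n → ∞ uniformly on every bounded subset of ℝ × ℝ^N × ℝ, then for each t ∈ (0,τ], uₙ(t,·) − vₙ(t,·) → 0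 as n → ∞ uniformly on every compact subset of ℝ^N. -/
open MeasureTheory Set Filter RealInnerProductSpace

noncomputable section

lemma aux_small {N : ℕ} {ι : Type} (P : ι → Prop) (a : ℕ → ι → Euc N → ℝ) (C : ℝ)
    (hC : ∀ n i x, P i → a n i x ≤ C)
    (h : ∀ ρ : ℝ, 0 < ρ → ∀ ε : ℝ, 0 < ε → ∃ n₀ : ℕ, ∀ n ≥ n₀, ∀ i x, P i → ‖x‖ ≤ ρ → a n i x ≤ ε)
    (δ : ℝ) (hδ : 0 < δ) :
    ∃ n₀ : ℕ, ∀ n ≥ n₀, ∀ i x, P i → a n i x ≤ δ * Real.exp ‖x‖ := by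
  obtain ⟨n₀, hn₀⟩ := h (|C| / δ + 1) (by positivity) δ hδ
  refine ⟨n₀, fun n hn i x hi => ?_⟩
  by_cases hx : ‖x‖ ≤ |C| / δ + 1
  · refine (hn₀ n hn i x hi hx).trans ?_
    have := Real.one_le_exp (norm_nonneg x)
    nlinarith
  · push Not at hx
    have h1 := Real.add_one_le_exp ‖x‖
    have h2 : |C| / δ ≤ Real.exp ‖x‖ := by linarith
    rw [div_le_iff₀ hδ] at h2
    have := hC n i x hi
    have := le_abs_self C
    linarith

lemma aux_gronwall {N : ℕ} (κ : Euc N → ℝ) (hκ : KernelHyp κ) (r : ℝ)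
    (hr : ∀ z, κ z ≠ 0 → ‖z‖ ≤ r) (L : ℝ) (hL : 0 ≤ L) (τ : ℝ) (hτ : 0 < τ)
    (w D : ℝ → Euc N → ℝ) (C : ℝ) (hC : ∀ t ∈ Icc (0:ℝ) τ, ∀ x, |w t x| ≤ C)
    (hc : ∀ x, ContinuousOn (fun s => w s x) (Icc 0 τ))
    (hd : ∀ x, ∀ t ∈ Ioo (0:ℝ) τ, HasDerivAt (fun s => w s x) (D t x) t)
    (δ : ℝ) (hδ : 0 < δ)
    (hD : ∀ x, ∀ t ∈ Ioo (0:ℝ) τ,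
      |D t x| ≤ |∫ y, κ (y - x) * w t y| + L * |w t x| + δ * Real.exp ‖x‖)
    (h0 : ∀ x, |w 0 x| ≤ δ * Real.exp ‖x‖) :
    ∀ t ∈ Icc (0:ℝ) τ, ∀ x, |w t x| ≤
      2 * (1 + τ) * δ * Real.exp (2 * (Real.exp r + L) * t + ‖x‖) := by
  obtain ⟨hκc, hκ0, hκs, -, hκ1⟩ := hκ
  set A := Real.exp r + L with hA
  have hApos : 0 < A := by positivity
  set S : Set ℝ := {q | ∃ t ∈ Icc (0:ℝ) τ, ∃ x : Euc N,
    q = |w t x| * Real.exp (-(2 * A * t + ‖x‖))} with hS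
  have hSb : BddAbove S := by
    refine ⟨C, ?_⟩
    rintro q ⟨t, ht, x, rfl⟩
    have h1 := hC t ht x
    have h2 : Real.exp (-(2 * A * t + ‖x‖)) ≤ 1 := by
      rw [Real.exp_le_one_iff]
      have := ht.1
      have := norm_nonneg x
      have : 0 ≤ 2 * A * t := by positivity
      linarith
    calc _ ≤ |w t x| * 1 := by gcongr
      _ ≤ C := by linarith
  have hSn : S.Nonempty := ⟨_, 0, ⟨le_rfl, hτ.le⟩, 0, rfl⟩
  set M := sSup S with hM
  have hle : ∀ t ∈ Icc (0:ℝ) τ, ∀ x, |w t x| ≤ M * Real.exp (2 * A * t + ‖x‖) := by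
    intro t ht x
    have := le_csSup hSb ⟨t, ht, x, rfl⟩
    rw [Real.exp_neg, ← div_eq_mul_inv, div_le_iff₀ (Real.exp_pos _)] at this
    exact this
  have hM0 : 0 ≤ M := by
    have := (abs_nonneg _).trans (hle 0 ⟨le_rfl, hτ.le⟩ 0)
    exact nonneg_of_mul_nonneg_left this (Real.exp_pos _)
  have hint : ∀ x, ∀ t ∈ Icc (0:ℝ) τ, |∫ y, κ (y - x) * w t y| ≤
      Real.exp r * M * Real.exp (2 * A * t + ‖x‖) := by
    intro x t ht
    have hi : Integrable (fun y => κ (y - x)) :=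
      (hκc.integrable_of_hasCompactSupport hκs).comp_sub_right x
    have h1 : ‖∫ y, κ (y - x) * w t y‖ ≤
        ∫ y, κ (y - x) * (Real.exp r * M * Real.exp (2 * A * t + ‖x‖)) := by
      refine norm_integral_le_of_norm_le (hi.mul_const _) (Eventually.of_forall fun y => ?_)
      rw [Real.norm_eq_abs, abs_mul, abs_of_nonneg (hκ0 _)]
      by_cases hz : κ (y - x) = 0
      · simp [hz]
      · refine mul_le_mul_of_nonneg_left ?_ (hκ0 _)
        have h2 := hr _ hz
        have h3 : ‖y‖ ≤ r + ‖x‖ := by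
          have := norm_add_le (y - x) x
          rw [sub_add_cancel] at this
          linarith
        refine (hle t ht y).trans ?_
        rw [mul_comm (Real.exp r) M, mul_assoc M, ← Real.exp_add]
        refine mul_le_mul_of_nonneg_left (Real.exp_le_exp.2 ?_) hM0
        linarith
    rw [integral_mul_const, integral_sub_right_eq_self (fun z => κ z) x, hκ1, one_mul] at h1
    exact h1
  have key : ∀ t ∈ Icc (0:ℝ) τ, ∀ x, |w t x| ≤
      ((1 + τ) * δ + M / 2) * Real.exp (2 * A * t + ‖x‖) := by
    intro t ht x
    set G : ℝ → ℝ := fun s => Real.exp ‖x‖ * (M / 2 * Real.exp (2 * A * s) + δ * s) with hG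
    have hGd : ∀ s, HasDerivAt G
        (Real.exp ‖x‖ * (A * M * Real.exp (2 * A * s) + δ)) s := by
      intro s
      have h1 : HasDerivAt (fun s : ℝ => 2 * A * s) (2 * A) s := by
        simpa using (hasDerivAt_id s).const_mul (2 * A)
      have h2 : HasDerivAt (fun s : ℝ => δ * s) δ s := by
        simpa using (hasDerivAt_id s).const_mul δ
      have h3 := (((h1.exp.const_mul (M / 2)).add h2).const_mul (Real.exp ‖x‖))
      refine h3.congr_deriv ?_
      ring
    have hDb : ∀ s ∈ Ioo (0:ℝ) τ,
        |D s x| ≤ Real.exp ‖x‖ * (A * M * Real.exp (2 * A * s) + δ) := by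
      intro s hs
      have h1 := hD x s hs
      have h2 := hint x s (Ioo_subset_Icc_self hs)
      have h3 := mul_le_mul_of_nonneg_left (hle s (Ioo_subset_Icc_self hs) x) hL
      rw [Real.exp_add] at h2 h3
      rw [hA]
      rw [hA] at h2 h3
      nlinarith
    have hGc : ContinuousOn G (Icc 0 τ) := fun s _ => (hGd s).continuousAt.continuousWithinAt
    have m1 : AntitoneOn (fun s => w s x - G s) (Icc 0 τ) := by
      refine antitoneOn_of_deriv_nonpos (convex_Icc _ _) ((hc x).sub hGc) ?_ ?_
      · intro s hs
        rw [interior_Icc] at hs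
        exact ((hd x s hs).sub (hGd s)).differentiableAt.differentiableWithinAt
      · intro s hs
        rw [interior_Icc] at hs
        rw [HasDerivAt.deriv (f := fun s => w s x - G s) ((hd x s hs).sub (hGd s))]
        have := (abs_le.1 (hDb s hs)).2
        linarith
    have m2 : MonotoneOn (fun s => w s x + G s) (Icc 0 τ) := by
      refine monotoneOn_of_deriv_nonneg (convex_Icc _ _) ((hc x).add hGc) ?_ ?_
      · intro s hs
        rw [interior_Icc] at hs
        exact ((hd x s hs).add (hGd s)).differentiableAt.differentiableWithinAt
      · intro s hs
        rw [interior_Icc] at hs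
        rw [HasDerivAt.deriv (f := fun s => w s x + G s) ((hd x s hs).add (hGd s))]
        have := (abs_le.1 (hDb s hs)).1
        linarith
    have hz : (0:ℝ) ∈ Icc 0 τ := ⟨le_rfl, hτ.le⟩
    have a1 := m1 hz ht ht.1
    have a2 := m2 hz ht ht.1
    have a3 := abs_le.1 (h0 x)
    have hG0 : 0 ≤ G 0 := by simp only [hG]; positivity
    have a4 : |w t x| ≤ δ * Real.exp ‖x‖ + G t := by
      rw [abs_le]
      simp only at a1 a2
      constructor <;> linarith [a3.1, a3.2]
    refine a4.trans ?_
    rw [Real.exp_add]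
    have e1 : 1 ≤ Real.exp (2 * A * t) := Real.one_le_exp (by have := ht.1; positivity)
    have e2 : δ + δ * t ≤ (1 + τ) * δ * Real.exp (2 * A * t) := by
      have : δ + δ * t ≤ (1 + τ) * δ := by nlinarith [ht.2]
      have h5 : 0 ≤ (1 + τ) * δ := by positivity
      nlinarith
    have e3 := mul_le_mul_of_nonneg_right e2 (Real.exp_pos ‖x‖).le
    simp only [hG]
    nlinarith
  have hMle : M ≤ (1 + τ) * δ + M / 2 := by
    refine csSup_le hSn ?_
    rintro q ⟨t, ht, x, rfl⟩
    rw [Real.exp_neg, ← div_eq_mul_inv, div_le_iff₀ (Real.exp_pos _)]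
    exact key t ht x
  intro t ht x
  refine (hle t ht x).trans ?_
  gcongr
  linarith

/-- convergence of solutions on compact subsets. -/
theorem stmt4 {N : ℕ} (hN : 1 ≤ N) (T M₀ : ℝ) (hT : 0 < T) (hM₀ : 0 < M₀)
    (κ : Euc N → ℝ) (hκ : KernelHyp κ)
    (f g : ℕ → ℝ → Euc N → ℝ → ℝ)
    (hf : ∀ n, SatH0 T M₀ (f n)) (hg : ∀ n, SatH0 T M₀ (g n))
    (hbd : ∀ R : ℝ, 0 < R → ∃ C, ∀ n t x u, |u| ≤ R →
      |f n t x u| + |g n t x u| + |deriv (fun v => f n t x v) u| ≤ C)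
    (τ : ℝ) (hτ : 0 < τ)
    (u₀ : Euc N → ℝ) (hu₀ : MemX u₀)
    (u₀n : ℕ → Euc N → ℝ) (hu₀n : ∀ n, MemX (u₀n n))
    (hu₀nb : ∃ C, ∀ n x, |u₀n n x| ≤ C)
    (U V : ℕ → ℝ → Euc N → ℝ)
    (hU : ∀ n, IsSol κ (f n) (U n) (Set.Icc 0 τ)) (hU0 : ∀ n x, U n 0 x = u₀n n x)
    (hV : ∀ n, IsSol κ (g n) (V n) (Set.Icc 0 τ)) (hV0 : ∀ n x, V n 0 x = u₀ x)
    (hUVb : ∃ C, ∀ n, ∀ t ∈ Set.Icc (0:ℝ) τ, ∀ x, |U n t x| + |V n t x| ≤ C)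
    (hconv0 : ∀ K : Set (Euc N), IsCompact K →
      TendstoUniformlyOn (fun n x => u₀n n x) u₀ atTop K)
    (hfg : ∀ R : ℝ, 0 < R → ∀ ε : ℝ, 0 < ε → ∃ n₀ : ℕ, ∀ n ≥ n₀, ∀ t x u,
      |t| ≤ R → ‖x‖ ≤ R → |u| ≤ R → |f n t x u - g n t x u| ≤ ε) :
    ∀ t ∈ Set.Ioc (0:ℝ) τ, ∀ K : Set (Euc N), IsCompact K →
      TendstoUniformlyOn (fun n x => U n t x - V n t x) (fun _ => (0:ℝ)) atTop K := by
  classical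
  obtain ⟨C0, hC0⟩ := hUVb
  set R : ℝ := |C0| + 1 with hR
  have hRpos : 0 < R := by positivity
  have hUR : ∀ n, ∀ t ∈ Set.Icc (0:ℝ) τ, ∀ x, |U n t x| ≤ R := fun n t ht x => by
    have := hC0 n t ht x
    have := abs_nonneg (V n t x)
    have := le_abs_self C0
    linarith
  have hVR : ∀ n, ∀ t ∈ Set.Icc (0:ℝ) τ, ∀ x, |V n t x| ≤ R := fun n t ht x => by
    have := hC0 n t ht x
    have := abs_nonneg (U n t x)
    have := le_abs_self C0
    linarith
  obtain ⟨C, hC⟩ := hbd R hRpos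
  have hCpos : 0 ≤ C := by
    refine le_trans ?_ (hC 0 0 0 0 (by simpa using hRpos.le))
    positivity
  obtain ⟨r, hr⟩ : ∃ r : ℝ, ∀ z, κ z ≠ 0 → ‖z‖ ≤ r := by
    obtain ⟨r, hr⟩ := hκ.2.2.1.isCompact.isBounded.exists_norm_le
    exact ⟨r, fun z hz => hr z (subset_tsupport _ hz)⟩
  set L : ℝ := 1 + C + R * C with hL
  have hLpos : 0 ≤ L := by positivity
  have hint : ∀ (v : Euc N → ℝ), MemX v → ∀ x, Integrable (fun y => κ (y - x) * v y) := by
    intro v hv x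
    refine Continuous.integrable_of_hasCompactSupport
      ((hκ.1.comp (continuous_id.sub continuous_const)).mul hv.1.continuous) ?_
    refine HasCompactSupport.mul_right ?_
    exact hκ.2.2.1.comp_homeomorph (Homeomorph.subRight x)
  have hlip : ∀ n t x a b, |a| ≤ R → |b| ≤ R → |f n t x a - f n t x b| ≤ C * |a - b| := by
    intro n t x a b ha hb
    have hdiff : Differentiable ℝ (fun v => f n t x v) := by
      have h1 := ((hf n).2.1 x).differentiable one_ne_zero
      exact h1.comp ((differentiable_const t).prodMk differentiable_id)
    refine Convex.norm_image_sub_le_of_norm_deriv_le (f := fun v => f n t x v)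
      (s := Icc (-R) R) (fun v _ => hdiff v) ?_ (convex_Icc _ _) (abs_le.1 hb) (abs_le.1 ha)
    intro v hv
    have := hC n t x v (abs_le.2 hv)
    have := abs_nonneg (f n t x v)
    have := abs_nonneg (g n t x v)
    rw [Real.norm_eq_abs]
    linarith
  -- main estimate
  have main : ∀ δ : ℝ, 0 < δ → ∃ n₀ : ℕ, ∀ n ≥ n₀, ∀ t ∈ Icc (0:ℝ) τ, ∀ x,
      |U n t x - V n t x| ≤
        2 * (1 + τ) * δ * Real.exp (2 * (Real.exp r + L) * t + ‖x‖) := by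
    intro δ hδ
    obtain ⟨n₁, hn₁⟩ := aux_small (N := N) (ι := ℝ × ℝ)
      (fun i => i.1 ∈ Icc (0:ℝ) τ ∧ |i.2| ≤ R)
      (fun n i x => R * |f n i.1 x i.2 - g n i.1 x i.2|) (R * C)
      (by
        rintro n ⟨t, u⟩ x ⟨-, hu⟩
        refine mul_le_mul_of_nonneg_left ?_ hRpos.le
        have := hC n t x u hu
        have := abs_nonneg (deriv (fun v => f n t x v) u)
        have := abs_sub (f n t x u) (g n t x u)
        linarith)
      (by
        intro ρ hρ ε hε
        obtain ⟨n₀, hn₀⟩ := hfg (ρ + τ + R) (by positivity) (ε / R) (by positivity)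
        refine ⟨n₀, ?_⟩
        rintro n hn ⟨t, u⟩ x ⟨ht, hu⟩ hx
        simp only at ht hu ⊢
        have := hn₀ n hn t x u (by rw [abs_of_nonneg ht.1]; linarith [ht.2])
          (by linarith) (by linarith)
        rw [le_div_iff₀ hRpos] at this
        linarith)
      δ hδ
    obtain ⟨C2, hC2⟩ := hu₀nb
    obtain ⟨C3, hC3⟩ := hu₀.2
    obtain ⟨n₂, hn₂⟩ := aux_small (N := N) (ι := Unit) (fun _ => True)
      (fun n _ x => |u₀n n x - u₀ x|) (C2 + C3)
      (by
        intro n _ x _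
        have := abs_sub (u₀n n x) (u₀ x)
        have := hC2 n x
        have := hC3 x
        linarith)
      (by
        intro ρ hρ ε hε
        have h1 := hconv0 (Metric.closedBall 0 ρ) (isCompact_closedBall _ _)
        rw [Metric.tendstoUniformlyOn_iff] at h1
        obtain ⟨n₀, hn₀⟩ := eventually_atTop.1 (h1 ε hε)
        refine ⟨n₀, fun n hn _ x _ hx => ?_⟩
        have := hn₀ n hn x (by simpa using hx)
        rw [dist_comm, Real.dist_eq] at this
        exact this.le)
      δ hδ
    refine ⟨max n₁ n₂, fun n hn => ?_⟩
    have hcont : ∀ (W : ℝ → Euc N → ℝ),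
        ContinuousOn (fun p : ℝ × Euc N => W p.1 p.2) (Icc 0 τ ×ˢ univ) →
        ∀ x, ContinuousOn (fun s => W s x) (Icc 0 τ) := by
      intro W hW x
      exact hW.comp (f := fun s : ℝ => (s, x)) (by fun_prop) (fun s hs => ⟨hs, mem_univ _⟩)
    refine aux_gronwall κ hκ r hr L hLpos τ hτ (fun t x => U n t x - V n t x)
      (fun t x => RHS κ (f n) (U n) t x - RHS κ (g n) (V n) t x) (R + R) ?_ ?_ ?_ δ hδ ?_ ?_
    · intro t ht x
      have := abs_sub (U n t x) (V n t x)
      have := hUR n t ht x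
      have := hVR n t ht x
      linarith
    · intro x
      exact (hcont _ (hU n).1 x).sub (hcont _ (hV n).1 x)
    · intro x t ht
      rw [← interior_Icc] at ht
      exact ((hU n).2.2.2 x t ht).sub ((hV n).2.2.2 x t ht)
    · intro x t ht
      have ht' := Ioo_subset_Icc_self ht
      have e1 : (∫ y, κ (y - x) * (U n t y - V n t y)) =
          (∫ y, κ (y - x) * U n t y) - ∫ y, κ (y - x) * V n t y := by
        rw [← integral_sub (hint _ ((hU n).2.1 t ht') x) (hint _ ((hV n).2.1 t ht') x)]
        simp only [mul_sub]
      simp only [RHS]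
      rw [e1]
      have hu := hUR n t ht' x
      have hv := hVR n t ht' x
      have b1 := hn₁ n (le_trans (le_max_left _ _) hn) (t, V n t x) x ⟨ht', hv⟩
      have b2 := hlip n t x _ _ hu hv
      have b3 : |f n t x (U n t x)| ≤ C := by
        have := hC n t x _ hu
        have := abs_nonneg (g n t x (U n t x))
        have := abs_nonneg (deriv (fun v => f n t x v) (U n t x))
        linarith
      simp only at b1
      generalize (∫ y, κ (y - x) * U n t y) = I1 at *
      generalize (∫ y, κ (y - x) * V n t y) = I2 at *
      generalize f n t x (U n t x) = fu at *
      generalize f n t x (V n t x) = fv at *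
      generalize g n t x (V n t x) = gv at *
      generalize U n t x = p at *
      generalize V n t x = q at *
      have e2 : I1 - p + p * fu - (I2 - q + q * gv) =
          (I1 - I2) + (-(p - q)) + (p - q) * fu + q * (fu - fv) + q * (fv - gv) := by ring
      rw [e2]
      have c1 := abs_add_le ((I1 - I2) + (-(p - q)) + (p - q) * fu + q * (fu - fv)) (q * (fv - gv))
      have c2 := abs_add_le ((I1 - I2) + (-(p - q)) + (p - q) * fu) (q * (fu - fv))
      have c3 := abs_add_le ((I1 - I2) + (-(p - q))) ((p - q) * fu)
      have c4 := abs_add_le (I1 - I2) (-(p - q))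
      rw [abs_neg] at c4
      have d1 : |(p - q) * fu| ≤ |p - q| * C := by rw [abs_mul]; gcongr
      have d2 : |q * (fu - fv)| ≤ R * (C * |p - q|) := by rw [abs_mul]; gcongr
      have d3 : |q * (fv - gv)| ≤ R * |fv - gv| := by rw [abs_mul]; gcongr
      rw [hL]
      nlinarith
    · intro x
      simp only [hU0, hV0]
      exact hn₂ n (le_trans (le_max_right _ _) hn) () x trivial
  intro t ht K hK
  obtain ⟨ρ, hρ⟩ := hK.isBounded.exists_norm_le
  rw [Metric.tendstoUniformlyOn_iff]
  intro ε hε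
  set Q := 2 * (1 + τ) * Real.exp (2 * (Real.exp r + L) * t + ρ) with hQ
  have hQpos : 0 < Q := by positivity
  obtain ⟨n₀, hn₀⟩ := main (ε / (2 * Q)) (by positivity)
  filter_upwards [eventually_ge_atTop n₀] with n hn x hx
  rw [dist_comm, Real.dist_eq, sub_zero]
  refine (hn₀ n hn t (Ioc_subset_Icc_self ht) x).trans_lt ?_
  calc _ ≤ 2 * (1 + τ) * (ε / (2 * Q)) * Real.exp (2 * (Real.exp r + L) * t + ρ) := by
        gcongr
        exact hρ x hx
    _ = Q * (ε / (2 * Q)) := by rw [hQ]; ring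
    _ = ε / 2 := by field_simp
    _ < ε := by linarith

end
end

section
/- Convergence of solutions on strip-type subsets (nonlocal dispersal case). Fix a unit vector ξ ∈ ℝ^N. Let fₙ and gₙ (n ∈ ℕ) each satisfy (H0) (with the same T and M₀), and suppose that for every R > 0, sup_n sup{ |fₙ(t,x,u)| + |gₙ(t,x,u)| + |∂_u fₙ(t,x,u)| : t ∈ ℝ, x ∈ ℝ^N, |u| ≤ R } < ∞. Fix τ > 0, u₀ ∈ X and u₀ₙ ∈ X with sup_n ‖u₀ₙ‖ < ∞. Let uₙ be a solution of (E_{fₙ}) on [0,τ] with uₙ(0,·) = u₀ₙ and vₙ a solution of (E_{gₙ}) on [0,τ] with vₙ(0,·) = u₀, and assume sup_n sup_{t∈[0,τ]} (‖uₙ(t,·)‖ + ‖vₙ(t,·)‖) < ∞. If u₀ₙ → u₀ as n → ∞ uniformly on every set E ⊆ ℝ^N for which { x·ξ : x ∈ E } is bounded, and fₙ − gₙ → 0 as n → ∞ uniformly on every set E ⊆ ℝ × ℝ^N × ℝ for which { (t, x·ξ, u) : (t,x,u) ∈ E } is bounded, then for each t ∈ (0,τ], uₙ(t,·) − vₙ(t,·)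 → 0 as n → ∞ uniformly on every set E ⊆ ℝ^N for which { x·ξ : x ∈ E } is bounded. -/
open MeasureTheory Set Filter RealInnerProductSpace

noncomputable section

lemma aux_kernel {N : ℕ} (κ : Euc N → ℝ) (hκ : KernelHyp κ) :
    ∃ r : ℝ, 0 ≤ r ∧ ∀ x : Euc N, (∀ w : Euc N → ℝ, Continuous w →
        Integrable (fun y => κ (y - x) * w y)) ∧
      ∀ (w : Euc N → ℝ) (b : ℝ), Continuous w →
      (∀ y, ‖y - x‖ ≤ r → |w y| ≤ b) → |∫ y, κ (y - x) * w y| ≤ b := by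
  obtain ⟨hc, hnn, hcs, -, hint⟩ := hκ
  obtain ⟨r, hr⟩ := hcs.isCompact.isBounded.exists_norm_le
  have hI : ∀ x : Euc N, ∀ w : Euc N → ℝ, Continuous w →
        Integrable (fun y => κ (y - x) * w y) := by
    intro x w hw
    have h1 : HasCompactSupport (fun y => κ (y - x)) :=
      hcs.comp_homeomorph (Homeomorph.subRight x)
    exact ((hc.comp (continuous_id.sub continuous_const)).mul hw).integrable_of_hasCompactSupport
      (h1.mul_right)
  refine ⟨max r 0, le_max_right _ _, fun x => ⟨hI x, ?_⟩⟩
  intro w b hw hb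
  have e : ∫ y, κ (y - x) * b = b := by
    rw [integral_mul_const, integral_sub_right_eq_self κ x, hint, one_mul]
  calc |∫ y, κ (y - x) * w y| ≤ ∫ y, |κ (y - x) * w y| := abs_integral_le_integral_abs
    _ ≤ ∫ y, κ (y - x) * b := by
        refine integral_mono (hI x w hw).abs (hI x _ continuous_const) ?_
        intro y
        show |κ (y - x) * w y| ≤ κ (y - x) * b
        rw [abs_mul, abs_of_nonneg (hnn _)]
        by_cases h : κ (y - x) = 0
        · simp [h]
        · exact mul_le_mul_of_nonneg_left
            (hb y ((hr _ (subset_tsupport _ h)).trans (le_max_left _ _))) (hnn _)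
    _ = b := e

lemma aux_ode (w w' B B' : ℝ → ℝ) (τ : ℝ) (hw : ContinuousOn w (Icc 0 τ))
    (hw' : ∀ t ∈ Ioo 0 τ, HasDerivAt w (w' t) t) (hB : ∀ t, HasDerivAt B (B' t) t)
    (h0 : |w 0| ≤ B 0) (hb : ∀ t ∈ Ioo 0 τ, |w' t| ≤ B' t) :
    ∀ t ∈ Icc 0 τ, |w t| ≤ B t := by
  intro t ht
  have hBc : ContinuousOn B (Icc 0 τ) := fun s _ => (hB s).continuousAt.continuousWithinAt
  have h0m : (0:ℝ) ∈ Icc 0 τ := ⟨le_rfl, ht.1.trans ht.2⟩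
  have key : ∀ (v v' : ℝ → ℝ), ContinuousOn v (Icc 0 τ) →
      (∀ t ∈ Ioo 0 τ, HasDerivAt v (v' t) t) → |v 0| ≤ B 0 →
      (∀ t ∈ Ioo 0 τ, |v' t| ≤ B' t) → v t ≤ B t := by
    intro v v' hv hv' h0 hb
    have hm : MonotoneOn (fun s => B s - v s) (Icc 0 τ) := by
      refine monotoneOn_of_deriv_nonneg (convex_Icc 0 τ) (hBc.sub hv) ?_ ?_
      · intro s hs
        rw [interior_Icc] at hs
        exact ((hB s).sub (hv' s hs)).differentiableAt.differentiableWithinAt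
      · intro s hs
        rw [interior_Icc] at hs
        have h1 := ((hB s).sub (hv' s hs)).deriv
        have h2 : deriv (fun s => B s - v s) s = B' s - v' s := h1
        rw [h2]
        have := (abs_le.1 (hb s hs)).2
        linarith
    have h1 := hm h0m ht ht.1
    have := (abs_le.1 h0).2
    simp only at h1
    linarith
  have k1 := key w w' hw hw' h0 hb
  have k2 := key (fun s => - w s) (fun s => - w' s) hw.neg (fun s hs => (hw' s hs).neg)
    (by simpa using h0) (by simpa using hb)
  exact abs_le.2 ⟨by linarith, k1⟩

lemma aux_lip_s5 (F : ℝ → ℝ) (hF : Differentiable ℝ F) (M C : ℝ)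
    (hb : ∀ u, |u| ≤ M → |F u| ≤ C ∧ |deriv F u| ≤ C) (u v : ℝ) (hu : |u| ≤ M) (hv : |v| ≤ M) :
    |u * F u - v * F v| ≤ (C + M * C) * |u - v| := by
  have h := (convex_Icc (-M) M).norm_image_sub_le_of_norm_deriv_le (f := F) (C := C)
    (fun x _ => hF x) (fun x hx => by
      rw [Real.norm_eq_abs]; exact (hb x (abs_le.2 hx)).2) (abs_le.1 hv) (abs_le.1 hu)
  rw [Real.norm_eq_abs, Real.norm_eq_abs] at h
  have hM : 0 ≤ M := (abs_nonneg _).trans hu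
  have e : u * F u - v * F v = (u - v) * F u + v * (F u - F v) := by ring
  rw [e]
  calc _ ≤ |(u - v) * F u| + |v * (F u - F v)| := abs_add_le _ _
    _ = |u - v| * |F u| + |v| * |F u - F v| := by rw [abs_mul, abs_mul]
    _ ≤ |u - v| * C + M * (C * |u - v|) := by
        gcongr
        exact (hb u hu).1
    _ = _ := by ring

/-- One comparison step. -/
lemma aux_step {N : ℕ} (κ : Euc N → ℝ) (ξ : Euc N) (hξ : ‖ξ‖ = 1) (r : ℝ)
    (hr : ∀ x : Euc N, (∀ w : Euc N → ℝ, Continuous w →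
        Integrable (fun y => κ (y - x) * w y)) ∧
      ∀ (w : Euc N → ℝ) (b : ℝ), Continuous w →
      (∀ y, ‖y - x‖ ≤ r → |w y| ≤ b) → |∫ y, κ (y - x) * w y| ≤ b)
    (hr0 : 0 ≤ r)
    (f g : ℝ → Euc N → ℝ → ℝ) (hfd : ∀ t x, Differentiable ℝ (f t x))
    (M C : ℝ) (hb : ∀ t x u, |u| ≤ M → |f t x u| ≤ C ∧ |deriv (f t x) u| ≤ C)
    (τ : ℝ) (u v : ℝ → Euc N → ℝ) (hu : IsSol κ f u (Icc 0 τ)) (hv : IsSol κ g v (Icc 0 τ))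
    (hub : ∀ t ∈ Icc 0 τ, ∀ x, |u t x| ≤ M) (hvb : ∀ t ∈ Icc 0 τ, ∀ x, |v t x| ≤ M)
    (K ε : ℝ) (hC : 0 ≤ C) (hM : 0 ≤ M)
    (h0 : ∀ x, |⟪x, ξ⟫| ≤ K → |u 0 x - v 0 x| ≤ ε)
    (hfg : ∀ t ∈ Icc 0 τ, ∀ x u, |⟪x, ξ⟫| ≤ K → |u| ≤ M → M * |f t x u - g t x u| ≤ ε)
    (b B : ℝ → ℝ)
    (hB : ∀ t, HasDerivAt B ((2 + C + M * C) * b t + ε) t) (hB0 : ε ≤ B 0)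
    (hw : ∀ t ∈ Icc 0 τ, ∀ x, |⟪x, ξ⟫| ≤ K → |u t x - v t x| ≤ b t) :
    ∀ t ∈ Icc 0 τ, ∀ x, |⟪x, ξ⟫| ≤ K - r → |u t x - v t x| ≤ B t := by
  intro t ht x hx
  have hcont : ∀ z : ℝ → Euc N → ℝ, ContinuousOn (fun p : ℝ × Euc N => z p.1 p.2)
      (Icc 0 τ ×ˢ univ) → ContinuousOn (fun s => z s x) (Icc 0 τ) := by
    intro z hz
    exact hz.comp (f := fun s : ℝ => (s, x))
      (continuous_id.prodMk continuous_const).continuousOn (fun s hs => ⟨hs, mem_univ _⟩)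
  refine aux_ode (fun s => u s x - v s x) (fun s => RHS κ f u s x - RHS κ g v s x) B
    (fun s => (2 + C + M * C) * b s + ε) τ
    ((hcont u hu.1).sub (hcont v hv.1)) ?_ hB ?_ ?_ t ht
  · intro s hs
    rw [← interior_Icc] at hs
    exact (hu.2.2.2 x s hs).sub (hv.2.2.2 x s hs)
  · exact (h0 x (by linarith)).trans hB0
  · intro s hs
    have hs' : s ∈ Icc 0 τ := Ioo_subset_Icc_self hs
    have huc : Continuous (u s) := (hu.2.1 s hs').1.continuous
    have hvc : Continuous (v s) := (hv.2.1 s hs').1.continuous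
    have hxK : |⟪x, ξ⟫| ≤ K := by linarith
    have i1 : |∫ y, κ (y - x) * (u s y - v s y)| ≤ b s := by
      refine (hr x).2 (fun y => u s y - v s y) (b s) (huc.sub hvc) ?_
      intro y hy
      apply hw s hs'
      have h1 : |⟪y - x, ξ⟫| ≤ r := (abs_real_inner_le_norm _ _).trans (by rw [hξ]; linarith)
      have h2 : ⟪y, ξ⟫ = ⟪y - x, ξ⟫ + ⟪x, ξ⟫ := by rw [inner_sub_left]; ring
      rw [h2]
      exact (abs_add_le _ _).trans (by linarith)
    have i2 : ∫ y, κ (y - x) * (u s y - v s y) =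
        (∫ y, κ (y - x) * u s y) - ∫ y, κ (y - x) * v s y := by
      rw [← integral_sub ((hr x).1 _ huc) ((hr x).1 _ hvc)]
      congr 1; ext y; ring
    have i3 := aux_lip_s5 (f s x) (hfd s x) M C (hb s x) (u s x) (v s x) (hub s hs' x) (hvb s hs' x)
    have i4 : |v s x * (f s x (v s x) - g s x (v s x))| ≤ ε := by
      rw [abs_mul]
      exact (mul_le_mul_of_nonneg_right (hvb s hs' x) (abs_nonneg _)).trans
        (hfg s hs' x _ hxK (hvb s hs' x))
    have i5 := hw s hs' x hxK
    have i6 : (C + M * C) * |u s x - v s x| ≤ (C + M * C) * b s := by gcongr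
    have e : RHS κ f u s x - RHS κ g v s x = (∫ y, κ (y - x) * (u s y - v s y))
        - (u s x - v s x) + (u s x * f s x (u s x) - v s x * f s x (v s x))
        + v s x * (f s x (v s x) - g s x (v s x)) := by
      rw [i2]; unfold RHS; ring
    show |RHS κ f u s x - RHS κ g v s x| ≤ (2 + C + M * C) * b s + ε
    rw [e]
    have i7 := i3.trans i6
    rw [abs_le] at *
    constructor <;> nlinarith

/-- convergence of solutions on strip-type subsets. -/
theorem stmt5 {N : ℕ} (hN : 1 ≤ N) (T M₀ : ℝ) (hT : 0 < T) (hM₀ : 0 < M₀)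
    (κ : Euc N → ℝ) (hκ : KernelHyp κ)
    (ξ : Euc N) (hξ : ‖ξ‖ = 1)
    (f g : ℕ → ℝ → Euc N → ℝ → ℝ)
    (hf : ∀ n, SatH0 T M₀ (f n)) (hg : ∀ n, SatH0 T M₀ (g n))
    (hbd : ∀ R : ℝ, 0 < R → ∃ C, ∀ n t x u, |u| ≤ R →
      |f n t x u| + |g n t x u| + |deriv (fun v => f n t x v) u| ≤ C)
    (τ : ℝ) (hτ : 0 < τ)
    (u₀ : Euc N → ℝ) (hu₀ : MemX u₀)
    (u₀n : ℕ → Euc N → ℝ) (hu₀n : ∀ n, MemX (u₀n n))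
    (hu₀nb : ∃ C, ∀ n x, |u₀n n x| ≤ C)
    (U V : ℕ → ℝ → Euc N → ℝ)
    (hU : ∀ n, IsSol κ (f n) (U n) (Set.Icc 0 τ)) (hU0 : ∀ n x, U n 0 x = u₀n n x)
    (hV : ∀ n, IsSol κ (g n) (V n) (Set.Icc 0 τ)) (hV0 : ∀ n x, V n 0 x = u₀ x)
    (hUVb : ∃ C, ∀ n, ∀ t ∈ Set.Icc (0:ℝ) τ, ∀ x, |U n t x| + |V n t x| ≤ C)
    (hconv0 : ∀ S : Set (Euc N), Bornology.IsBounded ((fun x => ⟪x, ξ⟫) '' S) →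
      TendstoUniformlyOn (fun n x => u₀n n x) u₀ atTop S)
    (hfg : ∀ R : ℝ, 0 < R → ∀ ε : ℝ, 0 < ε → ∃ n₀ : ℕ, ∀ n ≥ n₀, ∀ t x u,
      |t| ≤ R → |⟪x, ξ⟫| ≤ R → |u| ≤ R → |f n t x u - g n t x u| ≤ ε) :
    ∀ t ∈ Set.Ioc (0:ℝ) τ, ∀ S : Set (Euc N),
      Bornology.IsBounded ((fun x => ⟪x, ξ⟫) '' S) →
      TendstoUniformlyOn (fun n x => U n t x - V n t x) (fun _ => (0:ℝ)) atTop S := by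
  obtain ⟨r, hr0, hr⟩ := aux_kernel κ hκ
  obtain ⟨M', hM'⟩ := hUVb
  set M := max M' 1 with hMdef
  have hM1 : 1 ≤ M := le_max_right _ _
  have hM0 : 0 < M := by linarith
  have hUV : ∀ n, ∀ t ∈ Icc (0:ℝ) τ, ∀ x, |U n t x| + |V n t x| ≤ M := fun n t ht x =>
    (hM' n t ht x).trans (le_max_left _ _)
  obtain ⟨C', hC'⟩ := hbd M hM0
  set C := max C' 0 with hCdef
  have hC0 : 0 ≤ C := le_max_right _ _
  have hb : ∀ n t x u, |u| ≤ M → |f n t x u| ≤ C ∧ |deriv (f n t x) u| ≤ C := by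
    intro n t x u hu
    have h1 := (hC' n t x u hu).trans (le_max_left _ 0)
    have h2 := abs_nonneg (f n t x u)
    have h3 := abs_nonneg (g n t x u)
    have h4 := abs_nonneg (deriv (fun v => f n t x v) u)
    exact ⟨by linarith, by show |deriv (fun v => f n t x v) u| ≤ C; linarith⟩
  have hfd : ∀ n t x, Differentiable ℝ (f n t x) := by
    intro n t x
    have h1 : Differentiable ℝ (fun p : ℝ × ℝ => f n p.1 x p.2) :=
      ((hf n).2.1 x).differentiable (by simp)
    exact h1.comp (f := fun v : ℝ => (t, v)) (by fun_prop)
  set Λ := 2 + C + M * C with hΛ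
  have hMC : 0 ≤ M * C := mul_nonneg hM0.le hC0
  have hΛ0 : 0 < Λ := by linarith
  -- the iterated estimate
  have main : ∀ (n : ℕ) (ε K : ℝ), 0 ≤ ε →
      (∀ x, |⟪x, ξ⟫| ≤ K → |U n 0 x - V n 0 x| ≤ ε) →
      (∀ t ∈ Icc 0 τ, ∀ x u, |⟪x, ξ⟫| ≤ K → |u| ≤ M → M * |f n t x u - g n t x u| ≤ ε) →
      ∀ j : ℕ, ∀ t ∈ Icc 0 τ, ∀ x, |⟪x, ξ⟫| ≤ K - j * r → |U n t x - V n t x| ≤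
        ε * (((Λ + 1) * Real.exp (Λ * t) - 1) / Λ) + M * ((Λ * t) ^ j / (j.factorial : ℝ)) := by
    intro n ε K hε h0 h1 j
    induction j with
    | zero =>
      intro t ht x _
      have h2 : |U n t x - V n t x| ≤ M := (abs_sub _ _).trans (hUV n t ht x)
      have h3 : 1 ≤ Real.exp (Λ * t) := Real.one_le_exp (mul_nonneg hΛ0.le ht.1)
      have h4 : 0 ≤ ε * (((Λ + 1) * Real.exp (Λ * t) - 1) / Λ) := by
        apply mul_nonneg hε
        apply div_nonneg _ hΛ0.le
        nlinarith
      simp only [pow_zero, Nat.factorial_zero, Nat.cast_one, div_one, mul_one]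
      linarith
    | succ j ih =>
      have hjr : 0 ≤ (j:ℝ) * r := by positivity
      have := aux_step κ ξ hξ r hr hr0 (f n) (g n) (hfd n) M C (hb n) τ (U n) (V n) (hU n) (hV n)
        (fun t ht x => by have := hUV n t ht x; have := abs_nonneg (V n t x); linarith)
        (fun t ht x => by have := hUV n t ht x; have := abs_nonneg (U n t x); linarith)
        (K - j * r) ε hC0 hM0.le (fun x hx => h0 x (by linarith))
        (fun t ht x u hx hu => h1 t ht x u (by linarith) hu)
        (fun t => ε * (((Λ + 1) * Real.exp (Λ * t) - 1) / Λ) +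
          M * ((Λ * t) ^ j / (j.factorial : ℝ)))
        (fun t => ε * (((Λ + 1) * Real.exp (Λ * t) - 1) / Λ) +
          M * ((Λ * t) ^ (j+1) / ((j+1).factorial : ℝ))) ?_ ?_ ih
      · intro t ht x hx
        refine this t ht x ?_
        push_cast at hx
        linarith
      · intro t
        rw [← hΛ]
        have d1 : HasDerivAt (fun t : ℝ => Λ * t) Λ t := by
          simpa using (hasDerivAt_id t).const_mul Λ
        have d2 := (((d1.exp.const_mul (Λ + 1)).sub_const 1).div_const Λ).const_mul ε
        have d3 := ((d1.pow (j+1)).div_const ((j+1).factorial : ℝ)).const_mul M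
        refine (d2.add d3).congr_deriv ?_
        have hf0 : (j.factorial : ℝ) ≠ 0 := by positivity
        have hj0 : (j:ℝ) + 1 ≠ 0 := by positivity
        rw [Nat.factorial_succ]
        push_cast
        have hΛne := hΛ0.ne'
        clear_value Λ
        field_simp
        ring
      · have hΛne := hΛ0.ne'
        clear_value Λ
        simp [hΛne]
  intro t ht S hS
  have ht' : t ∈ Icc 0 τ := ⟨ht.1.le, ht.2⟩
  obtain ⟨R₀, hR₀⟩ := hS.exists_norm_le
  rw [Metric.tendstoUniformlyOn_iff]
  intro η hη
  -- choose j
  have hlim := FloorSemiring.tendsto_pow_div_factorial_atTop (Λ * t)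
  have hlim2 : Tendsto (fun j : ℕ => M * ((Λ * t) ^ j / (j.factorial : ℝ))) atTop (nhds 0) := by
    simpa using hlim.const_mul M
  obtain ⟨j, hj⟩ := (hlim2.eventually (gt_mem_nhds (half_pos hη))).exists
  set A := ((Λ + 1) * Real.exp (Λ * t) - 1) / Λ with hA
  have hA0 : 0 < A := by
    have h3 : 1 ≤ Real.exp (Λ * t) := Real.one_le_exp (mul_nonneg hΛ0.le ht'.1)
    apply div_pos _ hΛ0
    nlinarith
  set ε := η / 2 / A with hε
  have hε0 : 0 < ε := by positivity
  set K := R₀ + j * r with hK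
  have e1 := hconv0 {x | |⟪x, ξ⟫| ≤ K} (by
    refine (Metric.isBounded_closedBall (x := (0:ℝ)) (r := K)).subset ?_
    rintro _ ⟨x, hx, rfl⟩
    simpa [Real.norm_eq_abs] using hx)
  rw [Metric.tendstoUniformlyOn_iff] at e1
  obtain ⟨n₀, hn₀⟩ := hfg (max (max K τ) M) (lt_max_of_lt_right hM0) (ε / M) (by positivity)
  filter_upwards [e1 ε hε0, eventually_ge_atTop n₀] with n hn1 hn2 x hx
  have hfin := main n ε K hε0.le ?_ ?_ j t ht' x ?_
  · rw [dist_comm, Real.dist_eq, sub_zero]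
    have : ε * A = η / 2 := by rw [hε]; field_simp
    rw [← hA] at hfin
    linarith
  · intro y hy
    have := hn1 y hy
    rw [dist_comm, Real.dist_eq] at this
    rw [hU0, hV0]
    exact this.le
  · intro s hs y u hy hu
    have := hn₀ n hn2 s y u
      (by rw [abs_of_nonneg hs.1]; exact hs.2.trans ((le_max_right _ _).trans (le_max_left _ _)))
      (hy.trans ((le_max_left _ _).trans (le_max_left _ _))) (hu.trans (le_max_right _ _))
    calc _ ≤ M * (ε / M) := mul_le_mul_of_nonneg_left this hM0.le
      _ = ε := by field_simp
  · have := hR₀ _ (mem_image_of_mem _ hx)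
    rw [Real.norm_eq_abs] at this
    rw [hK]
    linarith

end
end

section
/- Subhomogeneity estimate for solutions (nonlocal dispersal case). Assume f satisfies (H0). Let α ≥ 1, τ ∈ (0,∞], let u be a solution of (E_f) on [0,τ) with u(0,x) ≥ 0 for all x, and let w be a solution of (E_f) on [0,τ) with w(0,x) ≤ α u(0,x) for all x. Then w(t,x) ≤ α u(t,x) for all t ∈ [0,τ) and x ∈ ℝ^N. -/
open MeasureTheory Set Filter RealInnerProductSpace

noncomputable section

lemma kint {N : ℕ} {κ : Euc N → ℝ} (hκ : KernelHyp κ) {v : Euc N → ℝ} (hv : Continuous v)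
    (x : Euc N) : Integrable (fun y => κ (y - x) * v y) := by
  have hc : HasCompactSupport (fun y => κ (y - x)) := by
    have := hκ.2.2.1.comp_homeomorph (Homeomorph.subRight x)
    exact this
  have h1 : Continuous (fun y => κ (y - x)) := hκ.1.comp (continuous_id.sub continuous_const)
  exact (h1.mul hv).integrable_of_hasCompactSupport hc.mul_right

lemma kint_ge {N : ℕ} {κ : Euc N → ℝ} (hκ : KernelHyp κ) {v : Euc N → ℝ} (hv : Continuous v)
    (A : ℝ) (hA : ∀ y, -A ≤ v y) (x : Euc N) : -A ≤ ∫ y, κ (y - x) * v y := by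
  have h1 : (∫ y, κ (y - x) * (-A)) = -A := by
    rw [integral_mul_const, integral_sub_right_eq_self κ x, hκ.2.2.2.2, one_mul]
  calc -A = ∫ y, κ (y - x) * (-A) := h1.symm
    _ ≤ _ := integral_mono (kint hκ continuous_const x) (kint hκ hv x)
      (fun y => mul_le_mul_of_nonneg_left (hA y) (hκ.2.1 _))

lemma comparison {N : ℕ} {κ : Euc N → ℝ} (hκ : KernelHyp κ) (s : ℝ) (B C : ℝ) (hB : 0 ≤ B)
    (hC : 0 ≤ C) (v D : ℝ → Euc N → ℝ)
    (hvb : ∀ t ∈ Icc 0 s, ∀ x, |v t x| ≤ C)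
    (hvx : ∀ t ∈ Icc 0 s, Continuous (v t))
    (hvt : ∀ x, ContinuousOn (fun t => v t x) (Icc 0 s))
    (hd : ∀ x, ∀ t ∈ Ioo 0 s, HasDerivAt (fun t => v t x) (D t x) t)
    (hD : ∀ x, ∀ t ∈ Ioo 0 s, ∃ c, |c| ≤ B ∧ (∫ y, κ (y - x) * v t y) + c * v t x ≤ D t x)
    (h0 : ∀ x, 0 ≤ v 0 x) : ∀ t ∈ Icc 0 s, ∀ x, 0 ≤ v t x := by
  set K : ℝ := 1 + 2 * B with hK
  set E : ℝ := Real.exp (B * s) * C with hE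
  have hE0 : 0 ≤ E := by positivity
  have key : ∀ n : ℕ, ∀ t ∈ Icc 0 s, ∀ x,
      -(E * ((K * t) ^ n / (n.factorial : ℝ))) ≤ Real.exp (B * t) * v t x := by
    intro n
    induction n with
    | zero =>
      intro t ht x
      have h1 := (abs_le.1 (hvb t ht x)).1
      have h2 : Real.exp (B * t) ≤ Real.exp (B * s) :=
        Real.exp_le_exp.2 (mul_le_mul_of_nonneg_left ht.2 hB)
      have h3 := Real.exp_pos (B * t)
      simp only [pow_zero, Nat.factorial_zero, Nat.cast_one, div_one, mul_one, hE]
      nlinarith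
    | succ n ih =>
      intro t ht x
      let F : ℝ → ℝ := fun r => Real.exp (B * r) * v r x +
        E * ((K * r) ^ (n + 1) / ((n + 1).factorial : ℝ))
      have hmono : MonotoneOn F (Icc 0 s) := by
        apply monotoneOn_of_hasDerivWithinAt_nonneg (convex_Icc 0 s) (f' := fun r =>
          (Real.exp (B * r) * B * v r x + Real.exp (B * r) * D r x) +
            E * (K * ((K * r) ^ n / (n.factorial : ℝ))))
        · apply ContinuousOn.add
          · exact (Continuous.continuousOn (by fun_prop)).mul (hvt x)
          · exact Continuous.continuousOn (by fun_prop)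
        · intro r hr
          rw [interior_Icc] at hr
          apply HasDerivAt.hasDerivWithinAt
          apply HasDerivAt.add
          · apply HasDerivAt.mul _ (hd x r hr)
            have := ((hasDerivAt_id r).const_mul B).exp
            simpa using this
          · apply HasDerivAt.const_mul
            have h := ((((hasDerivAt_id r).const_mul K).pow (n+1)).div_const
              ((n + 1).factorial : ℝ))
            convert h using 1
            · rfl
            simp only [Nat.factorial_succ, Nat.cast_mul, id, Nat.add_sub_cancel]
            have h1 : (n.factorial : ℝ) ≠ 0 := by positivity
            have h2 : ((n + 1 : ℕ) : ℝ) ≠ 0 := by positivity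
            field_simp
        · intro r hr
          rw [interior_Icc] at hr
          have hr' := Ioo_subset_Icc_self hr
          obtain ⟨c, hc, hcD⟩ := hD x r hr
          set A := E * ((K * r) ^ n / (n.factorial : ℝ)) with hA
          have hA0 : 0 ≤ A := by
            have : 0 ≤ r := hr.1.le
            positivity
          have e0 := Real.exp_pos (B * r)
          have h1 := kint_ge hκ (v := fun y => Real.exp (B * r) * v r y)
            (continuous_const.mul (hvx r hr')) A (ih r hr') x
          have h2 : (∫ y, κ (y - x) * (Real.exp (B * r) * v r y)) =
              Real.exp (B * r) * ∫ y, κ (y - x) * v r y := by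
            rw [← integral_const_mul]; congr 1; ext y; ring
          rw [h2] at h1
          have h3 := mul_le_mul_of_nonneg_left hcD e0.le
          have h4 := ih r hr' x
          rw [← hA] at h4
          have hc' := abs_le.1 hc
          have h5 : -(2 * B * A) ≤ (B + c) * (Real.exp (B * r) * v r x) := by
            have := mul_le_mul_of_nonneg_left h4 (by linarith : 0 ≤ B + c)
            nlinarith
          have h6 : E * (K * ((K * r) ^ n / (n.factorial : ℝ))) = K * A := by
            rw [hA]; ring
          show 0 ≤ _ + _
          rw [h6, hK]
          nlinarith
      have h := hmono ⟨le_rfl, ht.1.trans ht.2⟩ ht ht.1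
      have hF0 : F 0 = v 0 x := by simp [F]
      rw [hF0] at h
      have := h0 x
      simp only [F] at h
      linarith
  intro t ht x
  have hlim : Tendsto (fun n : ℕ => -(E * ((K * t) ^ n / (n.factorial : ℝ)))) atTop
      (nhds (-(E * 0))) :=
    ((FloorSemiring.tendsto_pow_div_factorial_atTop (K * t)).const_mul E).neg
  have h := le_of_tendsto' hlim (fun n => key n t ht x)
  simp only [mul_zero, neg_zero] at h
  exact nonneg_of_mul_nonneg_right h (Real.exp_pos _)

/-- subhomogeneity estimate for solutions. -/
theorem stmt6 {N : ℕ} (hN : 1 ≤ N) (T M₀ : ℝ) (hT : 0 < T) (hM₀ : 0 < M₀)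
    (κ : Euc N → ℝ) (hκ : KernelHyp κ)
    (f : ℝ → Euc N → ℝ → ℝ) (hf : SatH0 T M₀ f)
    (α : ℝ) (hα : 1 ≤ α)
    (I : Set ℝ) (hI : (∃ τ > 0, I = Set.Ico 0 τ) ∨ I = Set.Ici (0:ℝ))
    (u w : ℝ → Euc N → ℝ)
    (hu : IsSol κ f u I) (hw : IsSol κ f w I)
    (hu0 : ∀ x, 0 ≤ u 0 x) (hw0 : ∀ x, w 0 x ≤ α * u 0 x) :
    ∀ t ∈ I, ∀ x, w t x ≤ α * u t x := by
  have hI0 : ∀ s ∈ I, 0 ≤ s ∧ Icc 0 s ⊆ I ∧ Ioo 0 s ⊆ interior I := by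
    intro s hs
    have h1 : 0 ≤ s ∧ Icc 0 s ⊆ I := by
      rcases hI with ⟨τ, hτ, rfl⟩ | rfl
      · exact ⟨hs.1, fun r hr => ⟨hr.1, hr.2.trans_lt hs.2⟩⟩
      · exact ⟨hs, fun r hr => hr.1⟩
    exact ⟨h1.1, h1.2, interior_maximal (Ioo_subset_Icc_self.trans h1.2) isOpen_Ioo⟩
  intro s hs
  obtain ⟨hs0, hsub, hint⟩ := hI0 s hs
  obtain ⟨Cu, hCu⟩ := hu.2.2.1 _ hsub isCompact_Icc
  obtain ⟨Cw, hCw⟩ := hw.2.2.1 _ hsub isCompact_Icc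
  have hCu0 : 0 ≤ Cu := (abs_nonneg _).trans (hCu 0 ⟨le_rfl, hs0⟩ 0)
  have hCw0 : 0 ≤ Cw := (abs_nonneg _).trans (hCw 0 ⟨le_rfl, hs0⟩ 0)
  set R : ℝ := α * Cu + Cw + 1 with hR
  have hRpos : 0 < R := by positivity
  have hCuR : Cu ≤ R := by nlinarith
  obtain ⟨L, hL⟩ := (hf.2.2.1 R hRpos).1
  have hL0 : 0 ≤ L := le_trans (by positivity) (hL 0 0 0 (by simpa using hRpos.le))
  have hfL : ∀ t x r, |r| ≤ R → |f t x r| ≤ L := fun t x r hr => by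
    have := hL t x r hr
    linarith [abs_nonneg (deriv (fun s => f s x r) t), abs_nonneg (deriv (fun v => f t x v) r)]
  have hdL : ∀ t x r, |r| ≤ R → |deriv (fun v => f t x v) r| ≤ L := fun t x r hr => by
    have := hL t x r hr
    linarith [abs_nonneg (deriv (fun s => f s x r) t), abs_nonneg (f t x r)]
  have hdiff : ∀ t x, Differentiable ℝ (fun v => f t x v) := fun t x => by
    have h1 := (hf.2.1 x).differentiable one_ne_zero
    exact h1.comp (g := fun p : ℝ × ℝ => f p.1 x p.2) (f := fun v => (t, v)) (by fun_prop)
  have hlip : ∀ t x a b, |a| ≤ R → |b| ≤ R → |f t x a - f t x b| ≤ L * |a - b| := by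
    intro t x a b ha hb
    exact Convex.norm_image_sub_le_of_norm_deriv_le (f := fun v => f t x v) (s := Icc (-R) R)
      (fun z _ => hdiff t x z) (fun z hz => hdL t x z (abs_le.2 hz)) (convex_Icc _ _)
      (abs_le.1 hb) (abs_le.1 ha)
  have hanti : ∀ t x a b, 0 ≤ a → a ≤ b → f t x b ≤ f t x a := by
    intro t x a b ha hab
    obtain ⟨c, hc, hcd⟩ := hf.2.2.2.2 a b ha hab
    have := antitoneOn_of_deriv_nonpos (f := fun v => f t x v) (convex_Icc a b)
      (hdiff t x).continuous.continuousOn (hdiff t x).differentiableOn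
      (fun z hz => by
        have hz' := interior_subset hz
        exact (hcd t x z hz'.1 hz'.2).trans hc.le)
    exact this ⟨le_rfl, hab⟩ ⟨hab, le_rfl⟩ hab
  have hcont : ∀ v : ℝ → Euc N → ℝ, IsSol κ f v I → ∀ x,
      ContinuousOn (fun t => v t x) (Icc 0 s) := by
    intro v hv x
    exact hv.1.comp (f := fun t => (t, x)) (by fun_prop) (fun t ht => ⟨hsub ht, mem_univ _⟩)
  have hupos : ∀ t ∈ Icc 0 s, ∀ x, 0 ≤ u t x := by
    apply comparison hκ s (1 + L) Cu (by positivity) hCu0 u (RHS κ f u) hCu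
      (fun t ht => (hu.2.1 t (hsub ht)).1.continuous) (hcont u hu)
      (fun x t ht => hu.2.2.2 x t (hint ht)) _ hu0
    intro x t ht
    refine ⟨-1 + f t x (u t x), ?_, ?_⟩
    · have := hfL t x (u t x) ((hCu t (Ioo_subset_Icc_self ht) x).trans hCuR)
      rw [abs_le] at this ⊢
      constructor <;> linarith
    · unfold RHS
      apply le_of_eq; ring
  have hfin : ∀ t ∈ Icc 0 s, ∀ x, 0 ≤ α * u t x - w t x := by
    apply comparison hκ s (1 + (L + R * L)) R (by positivity) hRpos.le
      (fun t x => α * u t x - w t x) (fun t x => α * RHS κ f u t x - RHS κ f w t x)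
    · intro t ht x
      have h1 := abs_le.1 (hCu t ht x)
      have h2 := abs_le.1 (hCw t ht x)
      have h3 := mul_le_mul_of_nonneg_left h1.1 (zero_le_one.trans hα)
      have h4 := mul_le_mul_of_nonneg_left h1.2 (zero_le_one.trans hα)
      rw [abs_le]
      constructor <;> linarith
    · intro t ht
      exact (continuous_const.mul (hu.2.1 t (hsub ht)).1.continuous).sub
        (hw.2.1 t (hsub ht)).1.continuous
    · intro x
      exact (continuousOn_const.mul (hcont u hu x)).sub (hcont w hw x)
    · intro x t ht
      exact ((hu.2.2.2 x t (hint ht)).const_mul α).sub (hw.2.2.2 x t (hint ht))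
    · intro x t ht
      have ht' := Ioo_subset_Icc_self ht
      have hint1 : (∫ y, κ (y - x) * (α * u t y - w t y)) =
          α * (∫ y, κ (y - x) * u t y) - ∫ y, κ (y - x) * w t y := by
        rw [← integral_const_mul, ← integral_sub]
        · congr 1; ext y; ring
        · exact (kint hκ (hu.2.1 t (hsub ht')).1.continuous x).const_mul α
        · exact kint hκ (hw.2.1 t (hsub ht')).1.continuous x
      have hup := hupos t ht' x
      have haR : |α * u t x| ≤ R := by
        rw [abs_of_nonneg (by positivity)]
        have h4 := mul_le_mul_of_nonneg_left (abs_le.1 (hCu t ht' x)).2 (zero_le_one.trans hα)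
        linarith
      have hwR : |w t x| ≤ R := by
        have := hCw t ht' x
        have : 0 ≤ α * Cu := by positivity
        linarith
      have hsubh := mul_le_mul_of_nonneg_left (hanti t x (u t x) (α * u t x) hup (by nlinarith))
        (by positivity : 0 ≤ α * u t x)
      show ∃ c, |c| ≤ _ ∧ (∫ y, κ (y - x) * (α * u t y - w t y)) + c * (α * u t x - w t x) ≤
        α * RHS κ f u t x - RHS κ f w t x
      rw [hint1]
      unfold RHS
      generalize hb : w t x = b at *
      generalize ha : α * u t x = a at *
      have hq : ∃ c, |c| ≤ L + R * L ∧ c * (a - b) = a * f t x a - b * f t x b := by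
        rcases eq_or_ne a b with h | h
        · exact ⟨0, by rw [abs_zero]; positivity, by rw [h]; ring⟩
        · have hne : a - b ≠ 0 := sub_ne_zero.2 h
          refine ⟨(a * f t x a - b * f t x b) / (a - b), ?_, by field_simp⟩
          rw [abs_div, div_le_iff₀ (abs_pos.2 hne)]
          calc |a * f t x a - b * f t x b| = |(a - b) * f t x a + b * (f t x a - f t x b)| := by
                congr 1; ring
            _ ≤ |a - b| * |f t x a| + |b| * |f t x a - f t x b| := by
                rw [← abs_mul, ← abs_mul]; exact abs_add_le _ _
            _ ≤ |a - b| * L + R * (L * |a - b|) := by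
                gcongr
                · exact hfL t x a haR
                · exact hlip t x a b haR hwR
            _ = _ := by ring
      obtain ⟨c, hc, hce⟩ := hq
      refine ⟨-1 + c, ?_, ?_⟩
      · rw [abs_le] at hc ⊢
        constructor <;> linarith
      · have e1 : α * (u t x * f t x (u t x)) = a * f t x (u t x) := by rw [← ha]; ring
        have e2 : (-1 + c) * (a - b) = -(a - b) + (a * f t x a - b * f t x b) := by
          rw [← hce]; ring
        rw [e2, mul_add, mul_sub, e1, ha]
        linarith
    · intro x
      have := hw0 x
      show 0 ≤ α * u 0 x - w 0 x
      linarith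
  intro x
  have := hfin s ⟨hs0, le_rfl⟩ x
  linarith

end
end

section
/- Liouville type property (uniqueness of time periodic strictly positive solutions, nonlocal dispersal case). Assume f satisfies (H0). If u¹ and u² are time periodic strictly positive solutions of (E_f), then u¹(t,x) = u²(t,x) for all t ∈ ℝ and x ∈ ℝ^N. -/
open MeasureTheory Set Filter RealInnerProductSpace

noncomputable section

lemma aux_ode_s9 (T Λ η : ℝ) (hT : 0 < T) (hΛ : 0 < Λ) (w w' : ℝ → ℝ)
    (hw : ∀ t, HasDerivAt w (w' t) t) (hp : ∀ t, w (t + T) = w t)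
    (h : ∀ t, η - Λ * w t ≤ w' t) (t : ℝ) : η / Λ ≤ w t := by
  have hd : ∀ t, HasDerivAt (fun s => Real.exp (Λ * s) * (w s - η / Λ))
      (Real.exp (Λ * t) * (Λ * 1) * (w t - η / Λ) + Real.exp (Λ * t) * w' t) t := by
    intro t
    exact (((hasDerivAt_id t).const_mul Λ).exp).mul ((hw t).sub_const _)
  have hm : Monotone (fun s => Real.exp (Λ * s) * (w s - η / Λ)) := by
    apply monotone_of_deriv_nonneg
    · exact fun t => (hd t).differentiableAt
    · intro t
      rw [(hd t).deriv]
      have h1 : Real.exp (Λ * t) * (Λ * 1) * (w t - η / Λ) + Real.exp (Λ * t) * w' t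
          = Real.exp (Λ * t) * (w' t - (η - Λ * w t)) := by
        field_simp
        ring
      rw [h1]
      exact mul_nonneg (Real.exp_pos _).le (by linarith [h t])
  have h2 := hm (show t ≤ t + T by linarith)
  simp only [hp] at h2
  have h3 : Real.exp (Λ * t) < Real.exp (Λ * (t + T)) := by
    apply Real.exp_lt_exp.2
    nlinarith
  by_contra hc
  push Not at hc
  nlinarith

lemma aux_bdd {N : ℕ} {T : ℝ} (hT : 0 < T) {κ : Euc N → ℝ} {f : ℝ → Euc N → ℝ → ℝ}
    {u : ℝ → Euc N → ℝ} (h : PeriodicPosSol κ f T u) : ∃ C, ∀ t x, u t x ≤ C := by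
  obtain ⟨⟨-, -, hb, -⟩, hp, -⟩ := h
  obtain ⟨C, hC⟩ := hb (Icc 0 (0 + T)) (subset_univ _) isCompact_Icc
  refine ⟨C, fun t x => ?_⟩
  have hper : Function.Periodic (fun s => u s x) T := fun s => hp s x
  obtain ⟨s, hs, hst⟩ := hper.exists_mem_Ico₀ hT t
  have := hC s ⟨hs.1, by linarith [hs.2]⟩ x
  change u t x = u s x at hst
  rw [hst]
  exact (le_abs_self _).trans this

lemma aux_int_s9 {N : ℕ} {κ : Euc N → ℝ} (hκ : KernelHyp κ) (v : Euc N → ℝ) (hv : Continuous v)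
    (x : Euc N) : Integrable (fun y => κ (y - x) * v y) := by
  obtain ⟨hc, -, hs, -⟩ := hκ
  apply Continuous.integrable_of_hasCompactSupport
  · fun_prop
  · apply HasCompactSupport.mul_right
    exact hs.comp_homeomorph (Homeomorph.subRight x)

lemma aux_le {N : ℕ} (T M₀ : ℝ) (hT : 0 < T)
    (κ : Euc N → ℝ) (hκ : KernelHyp κ)
    (f : ℝ → Euc N → ℝ → ℝ) (hf : SatH0 T M₀ f)
    (u₁ u₂ : ℝ → Euc N → ℝ)
    (h₁ : PeriodicPosSol κ f T u₁) (h₂ : PeriodicPosSol κ f T u₂) :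
    ∀ t x, u₁ t x ≤ u₂ t x := by
  obtain ⟨C₁, hC₁⟩ := aux_bdd hT h₁
  obtain ⟨C₂, hC₂⟩ := aux_bdd hT h₂
  obtain ⟨⟨-, hX₁, -, hd₁⟩, hp₁, δ₁, hδ₁, hl₁⟩ := h₁
  obtain ⟨⟨-, hX₂, -, hd₂⟩, hp₂, δ, hδ, hl₂⟩ := h₂
  obtain ⟨-, hcd, hbd, -, hneg⟩ := hf
  have hC₁p : 0 < C₁ := by linarith [hl₁ 0 0, hC₁ 0 0]
  have hC₂p : 0 < C₂ := by linarith [hl₂ 0 0, hC₂ 0 0]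
  set S : Set ℝ := {α | ∀ t x, u₁ t x ≤ α * u₂ t x} with hS
  have hSne : C₁ / δ ∈ S := by
    intro t x
    calc u₁ t x ≤ C₁ := hC₁ t x
      _ = C₁ / δ * δ := by field_simp
      _ ≤ _ := mul_le_mul_of_nonneg_left (hl₂ t x) (by positivity)
  have hSb : BddBelow S := by
    refine ⟨0, fun α hα => ?_⟩
    by_contra hc
    push Not at hc
    have := hα 0 0
    nlinarith [hl₁ 0 0, hl₂ 0 0]
  have hScl : IsClosed S := by
    have : S = ⋂ t, ⋂ x, {α | u₁ t x ≤ α * u₂ t x} := by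
      ext α; simp [hS]
    rw [this]
    exact isClosed_iInter fun t => isClosed_iInter fun x =>
      isClosed_le continuous_const (by fun_prop)
  have hα : sInf S ∈ S := hScl.csInf_mem ⟨_, hSne⟩ hSb
  set α := sInf S with hαdef
  by_cases hα1 : α ≤ 1
  · intro t x
    have := hα t x
    nlinarith [hl₂ t x]
  push Not at hα1
  exfalso
  have hR : 0 < α * C₂ := by positivity
  obtain ⟨⟨L, hL⟩, -⟩ := hbd (α * C₂) hR
  obtain ⟨c, hc, hcd'⟩ := hneg 0 (α * C₂) le_rfl hR.le
  have hdiff : ∀ t x, Differentiable ℝ (fun v => f t x v) := by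
    intro t x
    have h := (hcd x).differentiable one_ne_zero
    exact h.comp (g := fun p : ℝ × ℝ => f p.1 x p.2) (f := fun v : ℝ => (t, v)) (by fun_prop)
  have hL0 : 0 ≤ L := by
    have := hL 0 0 0 (by simpa using hR.le)
    refine le_trans ?_ this
    positivity
  have key1 : ∀ t x a b, 0 ≤ a → a ≤ b → b ≤ α * C₂ → f t x b - f t x a ≤ c * (b - a) := by
    intro t x a b ha hab hb
    apply (convex_Icc a b).image_sub_le_mul_sub_of_deriv_le (hdiff t x).continuous.continuousOn
      (hdiff t x).differentiableOn _ a (left_mem_Icc.2 hab) b (right_mem_Icc.2 hab) hab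
    intro v hv
    have hv := interior_subset hv
    exact hcd' t x v (ha.trans hv.1) (hv.2.trans hb)
  have key2 : ∀ t x a b, 0 ≤ a → a ≤ b → b ≤ α * C₂ → (-L) * (b - a) ≤ f t x b - f t x a := by
    intro t x a b ha hab hb
    apply (convex_Icc a b).mul_sub_le_image_sub_of_le_deriv (hdiff t x).continuous.continuousOn
      (hdiff t x).differentiableOn _ a (left_mem_Icc.2 hab) b (right_mem_Icc.2 hab) hab
    intro v hv
    have hv := interior_subset hv
    have := hL t x v (by rw [abs_of_nonneg (ha.trans hv.1)]; exact hv.2.trans hb)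
    have h1 := neg_abs_le (deriv (fun v => f t x v) v)
    have h2 := abs_nonneg (f t x v)
    have h3 := abs_nonneg (deriv (fun s => f s x v) t)
    linarith
  set η := α * δ * (-c * ((α - 1) * δ)) with hη
  have hηp : 0 < η := by
    have : 0 < α - 1 := by linarith
    have : 0 < -c := by linarith
    positivity
  set Λ := 1 + α * C₂ * L + L with hΛ
  have hΛp : 0 < Λ := by positivity
  have main : ∀ t x, η / Λ ≤ α * u₂ t x - u₁ t x := by
    intro t x
    refine aux_ode_s9 T Λ η hT hΛp (fun s => α * u₂ s x - u₁ s x)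
      (fun s => α * RHS κ f u₂ s x - RHS κ f u₁ s x) ?_ ?_ ?_ t
    · intro s
      exact ((hd₂ x s (by simp)).const_mul α).sub (hd₁ x s (by simp))
    · intro s
      simp only [hp₁, hp₂]
    · intro s
      have hI : (∫ y, κ (y - x) * u₁ s y) ≤ α * ∫ y, κ (y - x) * u₂ s y := by
        rw [← integral_const_mul]
        apply integral_mono (aux_int_s9 hκ _ (hX₁ s (mem_univ _)).1.continuous x)
          ((aux_int_s9 hκ _ (hX₂ s (mem_univ _)).1.continuous x).const_mul α)
        intro y
        have := mul_le_mul_of_nonneg_left (hα s y) (hκ.2.1 (y - x))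
        simp only
        linarith
      have hw : u₁ s x ≤ α * u₂ s x := hα s x
      have a1 := hl₁ s x
      have a2 := hl₂ s x
      have b2 := hC₂ s x
      have hup : α * u₂ s x ≤ α * C₂ := by gcongr
      have k1 := key1 s x (u₂ s x) (α * u₂ s x) (by linarith) (by nlinarith) hup
      have k2 := key2 s x (u₁ s x) (α * u₂ s x) (by linarith) hw hup
      have k3 : -L ≤ f s x (u₁ s x) := by
        have := hL s x (u₁ s x) (by rw [abs_of_nonneg (by linarith)]; exact hw.trans hup)
        have h1 := neg_abs_le (f s x (u₁ s x))
        have h2 := abs_nonneg (deriv (fun v => f s x v) (u₁ s x))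
        have h3 := abs_nonneg (deriv (fun r => f r x (u₁ s x)) s)
        linarith
      simp only [RHS]
      generalize f s x (α * u₂ s x) = F at *
      generalize f s x (u₁ s x) = F1 at *
      generalize f s x (u₂ s x) = F2 at *
      generalize u₂ s x = v at *
      generalize hww : u₁ s x = u at *
      have e1 : η ≤ α * v * (-c * ((α - 1) * v)) := by
        have : 0 < α - 1 := by linarith
        have : 0 < -c := by linarith
        have : 0 ≤ α * v := by nlinarith
        rw [hη]
        gcongr
      have hw0 : 0 ≤ α * v - u := by linarith
      have e2 : α * v * (L * (α * v - u)) ≤ α * C₂ * (L * (α * v - u)) := by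
        gcongr
      have e3 : -L * (α * v - u) ≤ F1 * (α * v - u) := mul_le_mul_of_nonneg_right k3 hw0
      have hav : 0 ≤ α * v := by nlinarith
      have e4 : α * v * (-c * ((α - 1) * v) - L * (α * v - u)) ≤ α * v * (F2 - F1) := by
        apply mul_le_mul_of_nonneg_left _ hav
        linarith
      rw [hΛ]
      linarith
  have hmem : α - η / Λ / C₂ ∈ S := by
    intro t x
    have h1 := main t x
    have h2 : η / Λ / C₂ * u₂ t x ≤ η / Λ := by
      calc η / Λ / C₂ * u₂ t x ≤ η / Λ / C₂ * C₂ :=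
            mul_le_mul_of_nonneg_left (hC₂ t x) (by positivity)
        _ = η / Λ := by field_simp
    linarith
  have h3 := csInf_le hSb hmem
  have h4 : 0 < η / Λ / C₂ := by positivity
  linarith

/-- Liouville type property (uniqueness of time periodic strictly
positive solutions, nonlocal dispersal case). -/
theorem stmt9 {N : ℕ} (hN : 1 ≤ N) (T M₀ : ℝ) (hT : 0 < T) (hM₀ : 0 < M₀)
    (κ : Euc N → ℝ) (hκ : KernelHyp κ)
    (f : ℝ → Euc N → ℝ → ℝ) (hf : SatH0 T M₀ f)
    (u₁ u₂ : ℝ → Euc N → ℝ)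
    (h₁ : PeriodicPosSol κ f T u₁) (h₂ : PeriodicPosSol κ f T u₂) :
    ∀ t x, u₁ t x = u₂ t x := by
  intro t x
  exact le_antisymm (aux_le T M₀ hT κ hκ f hf u₁ u₂ h₁ h₂ t x)
    (aux_le T M₀ hT κ hκ f hf u₂ u₁ h₂ h₁ t x)

end
end

section
/- Liouville type property in the discrete (patchy) dispersal case. Assume f satisfies (H0_d). If u¹ and u² are time periodic strictly positive solutions of the lattice KPP equation ∂_t u(t,j) = Σ_{k∈K} a_k (u(t,j+k) − u(t,j)) + u(t,j) f(t,j,u(t,j)), then u¹(t,j) = u²(t,j) for all t ∈ ℝ and j ∈ ℤ^N. -/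
open MeasureTheory Set Filter RealInnerProductSpace

noncomputable section

/-- Lattice analogue of `X`: bounded functions on `ℤ^N`. -/
def LatMemX {N : ℕ} (u : (Fin N → ℤ) → ℝ) : Prop := ∃ C, ∀ j, |u j| ≤ C

/-- Right-hand side of the lattice KPP equation: the discrete dispersal operator
`Σ_{k∈K} a_k (u(t,j+k) − u(t,j))` (with `K` the set of unit lattice vectors,
encoded as `±eᵢ` for `i = 1,…,N`) plus the reaction term. -/
def LatRHS {N : ℕ} (a : Fin N → Bool → ℝ) (g : ℝ → (Fin N → ℤ) → ℝ → ℝ)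
    (u : ℝ → (Fin N → ℤ) → ℝ) (t : ℝ) (j : Fin N → ℤ) : ℝ :=
  (∑ i : Fin N, (a i true * (u t (j + Pi.single i 1) - u t j)
    + a i false * (u t (j - Pi.single i 1) - u t j)))
  + u t j * g t j (u t j)

/-- Hypothesis (H0_d) on the nonlinearity `f` in the discrete (patchy) setting. -/
def LatSatH0 {N : ℕ} (T M₀ : ℝ) (f : ℝ → (Fin N → ℤ) → ℝ → ℝ) : Prop :=
  (∀ t j u, f (t + T) j u = f t j u) ∧
  (∀ j, ContDiff ℝ 1 (fun p : ℝ × ℝ => f p.1 j p.2)) ∧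
  (∀ R : ℝ, 0 < R →
    (∃ C, ∀ t j u, |u| ≤ R →
      |f t j u| + |deriv (fun s => f s j u) t| + |deriv (fun v => f t j v) u| ≤ C) ∧
    (∀ ε : ℝ, 0 < ε → ∃ η > 0, ∀ t₁ t₂ : ℝ, ∀ j : Fin N → ℤ, ∀ u₁ u₂ : ℝ,
      |u₁| ≤ R → |u₂| ≤ R → |t₁ - t₂| ≤ η → |u₁ - u₂| ≤ η →
      |f t₁ j u₁ - f t₂ j u₂| ≤ ε ∧
      |deriv (fun s => f s j u₁) t₁ - deriv (fun s => f s j u₂) t₂| ≤ ε ∧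
      |deriv (fun v => f t₁ j v) u₁ - deriv (fun v => f t₂ j v) u₂| ≤ ε)) ∧
  (∀ t j u, M₀ ≤ u → f t j u < 0) ∧
  (∀ a b : ℝ, 0 ≤ a → a ≤ b → ∃ c < (0:ℝ), ∀ t j u, a ≤ u → u ≤ b →
    deriv (fun v => f t j v) u ≤ c)

/-- A solution of the lattice KPP equation on the interval `I`. -/
def LatIsSol {N : ℕ} (a : Fin N → Bool → ℝ) (g : ℝ → (Fin N → ℤ) → ℝ → ℝ)
    (u : ℝ → (Fin N → ℤ) → ℝ) (I : Set ℝ) : Prop :=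
  (∀ t ∈ I, LatMemX (u t)) ∧
  (∀ J : Set ℝ, J ⊆ I → IsCompact J → ∃ C, ∀ t ∈ J, ∀ j, |u t j| ≤ C) ∧
  (∀ j, ContinuousOn (fun t => u t j) I) ∧
  (∀ j, ∀ t ∈ interior I, HasDerivAt (fun s => u s j) (LatRHS a g u t j) t)

/-- A time periodic strictly positive solution of the lattice KPP equation. -/
def LatPeriodicPosSol {N : ℕ} (a : Fin N → Bool → ℝ) (g : ℝ → (Fin N → ℤ) → ℝ → ℝ)
    (T : ℝ) (u : ℝ → (Fin N → ℤ) → ℝ) : Prop :=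
  LatIsSol a g u univ ∧ (∀ t j, u (t + T) j = u t j) ∧ ∃ δ > 0, ∀ t j, δ ≤ u t j

lemma lat_le {N : ℕ} (T M₀ : ℝ) (hT : 0 < T)
    (a : Fin N → Bool → ℝ) (ha : ∀ i s, 0 < a i s)
    (f : ℝ → (Fin N → ℤ) → ℝ → ℝ) (hf : LatSatH0 T M₀ f)
    (u v : ℝ → (Fin N → ℤ) → ℝ)
    (hu : LatPeriodicPosSol a f T u) (hv : LatPeriodicPosSol a f T v) :
    ∀ t j, u t j ≤ v t j := by
  have bdd : ∀ w : ℝ → (Fin N → ℤ) → ℝ, LatPeriodicPosSol a f T w →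
      ∃ C, ∀ t j, w t j ≤ C := by
    rintro w ⟨⟨_, hb, _, _⟩, hp, _⟩
    obtain ⟨C, hC⟩ := hb (Icc 0 T) (subset_univ _) isCompact_Icc
    refine ⟨C, fun t j => ?_⟩
    have hper : Function.Periodic (fun s => w s j) T := fun s => hp s j
    obtain ⟨s, hs, hs'⟩ := hper.exists_mem_Ico₀ hT t
    have := hC s ⟨hs.1, hs.2.le⟩ j
    rw [hs']
    exact (le_abs_self _).trans this
  obtain ⟨C₁, hC₁⟩ := bdd u hu
  obtain ⟨C₂, hC₂⟩ := bdd v hv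
  obtain ⟨⟨_, _, hcu, hdu⟩, hpu, δ₁, hδ₁, hu0⟩ := hu
  obtain ⟨⟨_, _, hcv, hdv⟩, hpv, δ₂, hδ₂, hv0⟩ := hv
  obtain ⟨δ, hδ, hδu, hδv⟩ : ∃ δ > 0, (∀ t j, δ ≤ u t j) ∧ ∀ t j, δ ≤ v t j :=
    ⟨min δ₁ δ₂, lt_min hδ₁ hδ₂, fun t j => (min_le_left _ _).trans (hu0 t j),
      fun t j => (min_le_right _ _).trans (hv0 t j)⟩
  obtain ⟨M, huM, hvM⟩ : ∃ M, (∀ t j, u t j ≤ M) ∧ ∀ t j, v t j ≤ M :=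
    ⟨max C₁ C₂, fun t j => (hC₁ t j).trans (le_max_left _ _),
      fun t j => (hC₂ t j).trans (le_max_right _ _)⟩
  by_contra! hcon
  obtain ⟨t₀, j₀, h0⟩ := hcon
  have hvpos : ∀ t j, 0 < v t j := fun t j => hδ.trans_le (hδv t j)
  have hupos : ∀ t j, 0 < u t j := fun t j => hδ.trans_le (hδu t j)
  have hδM : δ ≤ M := (hδu 0 0).trans (huM 0 0)
  have hM : 0 < M := hδ.trans_le hδM
  obtain ⟨c, hc, hder⟩ := hf.2.2.2.2 δ M hδ.le hδM
  have hmono : ∀ t j x y, δ ≤ x → x ≤ y → y ≤ M → f t j y - f t j x ≤ c * (y - x) := by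
    intro t j x y hx hxy hy
    have hd : Differentiable ℝ (fun z => f t j z) := by
      have h1 := (hf.2.1 j).differentiable (by norm_num)
      exact h1.comp (g := fun p : ℝ × ℝ => f p.1 j p.2) (f := fun z : ℝ => (t, z)) (by fun_prop)
    refine (convex_Icc δ M).image_sub_le_mul_sub_of_deriv_le hd.continuous.continuousOn
      hd.differentiableOn ?_ x ⟨hx, hxy.trans hy⟩ y ⟨hx.trans hxy, hy⟩ hxy
    intro z hz
    have hz' := interior_subset hz
    exact hder t j z hz'.1 hz'.2
  set S : Set ℝ := range (fun p : ℝ × (Fin N → ℤ) => u p.1 p.2 / v p.1 p.2) with hS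
  have hSb : BddAbove S := by
    refine ⟨M / δ, ?_⟩
    rintro _ ⟨p, rfl⟩
    exact div_le_div₀ hM.le (huM _ _) hδ (hδv _ _)
  set α := sSup S with hα
  have hle : ∀ t j, u t j / v t j ≤ α := fun t j => le_csSup hSb ⟨(t, j), rfl⟩
  have hα1 : 1 < α := lt_of_lt_of_le ((one_lt_div (hvpos _ _)).2 h0) (hle t₀ j₀)
  set A : ℝ := ∑ i : Fin N, (a i true + a i false) with hA
  have hA0 : 0 ≤ A := Finset.sum_nonneg fun i _ => (add_pos (ha _ _) (ha _ _)).le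
  set κ : ℝ := δ * (-c * ((α - 1) / 2 * δ)) with hκ
  have hκ0 : 0 < κ := by
    have : 0 < -c := by linarith
    have : 0 < (α - 1) / 2 := by linarith
    positivity
  obtain ⟨ε, hε, hε1, hε2⟩ : ∃ ε > 0, ε ≤ (α - 1) / 2 ∧ A * M * ε < κ := by
    refine ⟨min ((α - 1) / 2) (κ / (A * M + 1)), lt_min (by linarith) (by positivity),
      min_le_left _ _, ?_⟩
    have h1 : A * M * min ((α - 1) / 2) (κ / (A * M + 1)) ≤ A * M * (κ / (A * M + 1)) := by
      gcongr
      exact min_le_right _ _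
    refine h1.trans_lt ?_
    rw [← mul_div_assoc, div_lt_iff₀ (by positivity)]
    nlinarith
  obtain ⟨_, ⟨⟨t₁, j⟩, rfl⟩, hlt⟩ := exists_lt_of_lt_csSup (s := S) ⟨_, ⟨(t₀, j₀), rfl⟩⟩
    (show α - ε < sSup S by linarith)
  simp only at hlt
  -- maximise in time
  have hcw : Continuous (fun s => u s j / v s j) := by
    have h1 := continuousOn_univ.1 (hcu j)
    have h2 := continuousOn_univ.1 (hcv j)
    exact h1.div h2 fun s => (hvpos s j).ne'
  have hpw : Function.Periodic (fun s => u s j / v s j) T := fun s => by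
    simp only [hpu, hpv]
  obtain ⟨τ, -, hτ⟩ := isCompact_Icc.exists_isMaxOn (nonempty_Icc.2 hT.le) hcw.continuousOn
  have hmax : ∀ s, u s j / v s j ≤ u τ j / v τ j := by
    intro s
    obtain ⟨r, hr, hr'⟩ := hpw.exists_mem_Ico₀ hT s
    rw [hr']
    exact hτ ⟨hr.1, hr.2.le⟩
  obtain ⟨W, hW⟩ : ∃ W, W = u τ j / v τ j := ⟨_, rfl⟩
  rw [← hW] at hmax
  have hWε : α - ε < W := hlt.trans_le (hmax t₁)
  have huW : u τ j = W * v τ j := by rw [hW, div_mul_cancel₀ _ (hvpos _ _).ne']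
  have hloc : IsLocalMax (fun s => u s j - W * v s j) τ := by
    refine Eventually.of_forall fun s => ?_
    have := (div_le_iff₀ (hvpos s j)).1 (hmax s)
    simp only
    linarith
  have hD := hloc.hasDerivAt_eq_zero
    ((hdu j τ (by simp)).sub ((hdv j τ (by simp)).const_mul W))
  have hk : ∀ k, u τ k - W * v τ k ≤ ε * M := by
    intro k
    have h1 := (div_le_iff₀ (hvpos τ k)).1 (hle τ k)
    have h2 : (α - W) * v τ k ≤ ε * v τ k :=
      mul_le_mul_of_nonneg_right (by linarith) (hvpos _ _).le
    have h3 : ε * v τ k ≤ ε * M := mul_le_mul_of_nonneg_left (hvM _ _) hε.le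
    linarith
  have hid : LatRHS a f u τ j - W * LatRHS a f v τ j
      = (∑ i : Fin N, (a i true * (u τ (j + Pi.single i 1) - W * v τ (j + Pi.single i 1))
          + a i false * (u τ (j - Pi.single i 1) - W * v τ (j - Pi.single i 1))))
        + u τ j * (f τ j (u τ j) - f τ j (v τ j)) := by
    have : u τ j * (f τ j (u τ j) - f τ j (v τ j))
        = u τ j * f τ j (u τ j) - W * (v τ j * f τ j (v τ j)) := by
      rw [mul_sub, ← mul_assoc W, ← huW]
    rw [this, LatRHS, LatRHS, mul_add, add_sub_add_comm, Finset.mul_sum, ← Finset.sum_sub_distrib]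
    congr 1
    refine Finset.sum_congr rfl fun i _ => ?_
    rw [huW]
    ring
  have hsum : (∑ i : Fin N, (a i true * (u τ (j + Pi.single i 1) - W * v τ (j + Pi.single i 1))
          + a i false * (u τ (j - Pi.single i 1) - W * v τ (j - Pi.single i 1)))) ≤ A * M * ε := by
    rw [hA, mul_assoc, Finset.sum_mul]
    refine Finset.sum_le_sum fun i _ => ?_
    have h1 := mul_le_mul_of_nonneg_left (hk (j + Pi.single i 1)) (ha i true).le
    have h2 := mul_le_mul_of_nonneg_left (hk (j - Pi.single i 1)) (ha i false).le
    linarith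
  have hgap : (α - 1) / 2 * δ ≤ u τ j - v τ j := by
    have h1 : (α - 1) / 2 * δ ≤ (W - 1) * v τ j :=
      mul_le_mul (by linarith) (hδv _ _) hδ.le (by linarith)
    linarith
  have hpos : 0 < (α - 1) / 2 * δ := mul_pos (by linarith) hδ
  have hf1 := hmono τ j (v τ j) (u τ j) (hδv _ _) (by linarith) (huM _ _)
  have hf2 : -c * ((α - 1) / 2 * δ) ≤ -(f τ j (u τ j) - f τ j (v τ j)) := by
    have := mul_le_mul_of_nonneg_left hgap (show 0 ≤ -c by linarith)
    linarith
  have hf3 : κ ≤ u τ j * (-(f τ j (u τ j) - f τ j (v τ j))) :=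
    mul_le_mul (hδu _ _) hf2 (mul_nonneg (by linarith) hpos.le) (hupos _ _).le
  linarith

/-- Liouville type property in the discrete (patchy) dispersal case. -/
theorem stmt10 {N : ℕ} (hN : 1 ≤ N) (T M₀ : ℝ) (hT : 0 < T) (hM₀ : 0 < M₀)
    (a : Fin N → Bool → ℝ) (ha : ∀ i s, 0 < a i s)
    (f : ℝ → (Fin N → ℤ) → ℝ → ℝ) (hf : LatSatH0 T M₀ f)
    (u₁ u₂ : ℝ → (Fin N → ℤ) → ℝ)
    (h₁ : LatPeriodicPosSol a f T u₁) (h₂ : LatPeriodicPosSol a f T u₂) :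
    ∀ t j, u₁ t j = u₂ t j := by
  intro t j
  exact le_antisymm (lat_le T M₀ hT a ha f hf u₁ u₂ h₁ h₂ t j)
    (lat_le T M₀ hT a ha f hf u₂ u₁ h₂ h₁ t j)

end
end

section
/- Asymptotic stability of the time periodic strictly positive solution, uniformly over time shifts (nonlocal dispersal case). Assume f satisfies (H0) and let u* be a time periodic strictly positive solution of (E_f). Then for every u₀ ∈ X with inf_x u₀(x) > 0 and every ε > 0, there exists t₀ > 0 such that for every τ ∈ ℝ, every solution v of the shifted equation ∂_t v(t,x) = ∫_{ℝ^N} κ(y−x) v(t,y) dy − v(t,x) + v(t,x) f(t+τ, x, v(t,x)) on [0,∞) with v(0,·) = u₀, and every t ≥ t₀, one has sup_{x ∈ ℝ^N} |v(t,x) − u*(t+τ,x)| ≤ ε. -/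
open MeasureTheory Set Filter RealInnerProductSpace

noncomputable section

lemma kernel_int {N : ℕ} (κ : Euc N → ℝ) (hκ : KernelHyp κ) (u : Euc N → ℝ) (hu : Continuous u)
    (x : Euc N) : Integrable (fun y => κ (y - x) * u y) := by
  obtain ⟨hc, -, hs, -, -⟩ := hκ
  apply Continuous.integrable_of_hasCompactSupport
  · fun_prop
  · have h1 : HasCompactSupport (fun y => κ (y - x)) :=
      hs.comp_homeomorph (Homeomorph.subRight x)
    exact h1.mul_right

lemma kernel_one {N : ℕ} (κ : Euc N → ℝ) (hκ : KernelHyp κ) (x : Euc N) :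
    ∫ y, κ (y - x) = 1 := by
  rw [integral_sub_right_eq_self (fun y => κ y) x]
  exact hκ.2.2.2.2

lemma kernel_ge {N : ℕ} (κ : Euc N → ℝ) (hκ : KernelHyp κ) (u : Euc N → ℝ) (hu : Continuous u)
    (m : ℝ) (hm : ∀ y, m ≤ u y) (x : Euc N) : m ≤ ∫ y, κ (y - x) * u y := by
  have h1 : ∫ y, κ (y - x) * m = m := by
    rw [integral_mul_const, kernel_one κ hκ x, one_mul]
  rw [← h1]
  apply integral_mono (kernel_int κ hκ (fun _ => m) continuous_const x) (kernel_int κ hκ u hu x)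
  intro y
  exact mul_le_mul_of_nonneg_left (hm y) (hκ.2.1 _)

lemma comp_step {N : ℕ} (κ : Euc N → ℝ) (hκ : KernelHyp κ) (b L : ℝ) (hL : 0 ≤ L)
    (z d : ℝ → Euc N → ℝ)
    (hcx : ∀ t ∈ Icc 0 b, Continuous (z t))
    (hct : ∀ x, ContinuousOn (fun t => z t x) (Icc 0 b))
    (h0 : ∀ x, 0 ≤ z 0 x)
    (hd : ∀ x, ∀ t, 0 < t → t ≤ b → HasDerivAt (fun s => z s x) (d t x) t)
    (hineq : ∀ x, ∀ t, 0 < t → t ≤ b →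
      (∫ y, κ (y - x) * z t y) - z t x - L * |z t x| ≤ d t x)
    (S : ℝ) (hS : 0 < S)
    (hz : ∀ t ∈ Icc 0 b, ∀ x, -(S * Real.exp ((L + 4) * t)) ≤ z t x) :
    ∀ t ∈ Icc 0 b, ∀ x, -(S / 2 * Real.exp ((L + 4) * t)) ≤ z t x := by
  intro t ht x
  rcases ht.1.eq_or_lt with h | h
  · rw [← h]
    have := h0 x
    have : 0 < S / 2 * Real.exp ((L + 4) * 0) := by positivity
    linarith
  have hb : 0 < b := h.trans_le ht.2
  have hev : ∀ᶠ s in nhdsWithin 0 (Icc 0 b), -(S/2) < z s x := by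
    have := (hct x) 0 ⟨le_rfl, hb.le⟩
    apply this.eventually
    apply lt_mem_nhds
    have := h0 x
    try dsimp only
    linarith
  have hev2 : ∀ᶠ s in nhdsWithin (0:ℝ) (Ioi 0), -(S/2) < z s x := by
    have h1 : nhdsWithin (0:ℝ) (Ioo 0 b) = nhdsWithin (0:ℝ) (Ioi 0) := nhdsWithin_Ioo_eq_nhdsGT hb
    rw [← h1]
    exact hev.filter_mono (nhdsWithin_mono _ Ioo_subset_Icc_self)
  have hev3 : ∀ᶠ s in nhdsWithin (0:ℝ) (Ioi 0), s ∈ Ioo 0 t := Ioo_mem_nhdsGT h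
  obtain ⟨η, hη1, hη2⟩ := (hev2.and hev3).exists
  have key := image_le_of_deriv_right_lt_deriv_boundary (f := fun s => - z s x)
    (f' := fun s => - d s x) (a := η) (b := b)
    (B := fun s => S / 2 * Real.exp ((L + 4) * s))
    (B' := fun s => S / 2 * (Real.exp ((L + 4) * s) * (L + 4)))
    (((hct x).mono (Icc_subset_Icc_left hη2.1.le)).neg)
    (fun s hs => ((hd x s (hη2.1.trans_le hs.1) hs.2.le).neg).hasDerivWithinAt)
    (by
      have : 1 ≤ Real.exp ((L+4) * η) := Real.one_le_exp (by have := hη2.1; positivity)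
      have : S / 2 * 1 ≤ S / 2 * Real.exp ((L+4) * η) :=
        mul_le_mul_of_nonneg_left this (by positivity)
      try simp only
      linarith)
    (fun s => by
      have h1 : HasDerivAt (fun s : ℝ => (L + 4) * s) (L + 4) s := by
        simpa using (hasDerivAt_id s).const_mul (L + 4)
      exact (h1.exp).const_mul (S / 2))
    (by
      intro s hs heq
      have hs0 : 0 < s := hη2.1.trans_le hs.1
      have hi := hineq x s hs0 hs.2.le
      have hk := kernel_ge κ hκ (z s) (hcx s ⟨hs0.le, hs.2.le⟩) _
        (hz s ⟨hs0.le, hs.2.le⟩) x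
      try dsimp only at heq ⊢
      have he : 0 < S * Real.exp ((L + 4) * s) := by positivity
      have hzz : z s x = -(S * Real.exp ((L + 4) * s)) / 2 := by linarith
      have habs : |z s x| = (S * Real.exp ((L + 4) * s)) / 2 := by
        rw [hzz, abs_of_nonpos (by linarith)]; ring
      rw [habs, hzz] at hi
      nlinarith)
  have := key (x := t) ⟨hη2.2.le, ht.2⟩
  try dsimp only at this
  linarith

lemma comp_nonneg {N : ℕ} (κ : Euc N → ℝ) (hκ : KernelHyp κ) (b L : ℝ) (hL : 0 ≤ L)
    (z d : ℝ → Euc N → ℝ)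
    (hcx : ∀ t ∈ Icc 0 b, Continuous (z t))
    (hct : ∀ x, ContinuousOn (fun t => z t x) (Icc 0 b))
    (h0 : ∀ x, 0 ≤ z 0 x)
    (hd : ∀ x, ∀ t, 0 < t → t ≤ b → HasDerivAt (fun s => z s x) (d t x) t)
    (hineq : ∀ x, ∀ t, 0 < t → t ≤ b →
      (∫ y, κ (y - x) * z t y) - z t x - L * |z t x| ≤ d t x)
    (C : ℝ) (hbd : ∀ t ∈ Icc 0 b, ∀ x, |z t x| ≤ C) :
    ∀ t ∈ Icc 0 b, ∀ x, 0 ≤ z t x := by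
  have hn : ∀ n : ℕ, ∀ t ∈ Icc 0 b, ∀ x,
      -((|C| + 1) / 2 ^ n * Real.exp ((L + 4) * t)) ≤ z t x := by
    intro n
    induction n with
    | zero =>
      intro t ht x
      have h1 := neg_le_of_abs_le (hbd t ht x)
      have h2 : 1 ≤ Real.exp ((L + 4) * t) := Real.one_le_exp (by have := ht.1; positivity)
      have h3 := le_abs_self C
      have h4 : (|C| + 1) * 1 ≤ (|C| + 1) * Real.exp ((L + 4) * t) :=
        mul_le_mul_of_nonneg_left h2 (by positivity)
      simp only [pow_zero, div_one]
      linarith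
    | succ n ih =>
      have := comp_step κ hκ b L hL z d hcx hct h0 hd hineq _ (by positivity) ih
      intro t ht x
      have := this t ht x
      rwa [div_div, ← pow_succ] at this
  intro t ht x
  have hlim : Tendsto (fun n : ℕ => -((|C| + 1) / 2 ^ n * Real.exp ((L + 4) * t))) atTop
      (nhds (-(0 * Real.exp ((L + 4) * t)))) := by
    apply Tendsto.neg
    apply Tendsto.mul_const
    exact tendsto_const_nhds.div_atTop (tendsto_pow_atTop_atTop_of_one_lt (by norm_num))
  have := le_of_tendsto' hlim (fun n => hn n t ht x)
  simpa using this

lemma slice_diff {N : ℕ} {T M₀ : ℝ} {f : ℝ → Euc N → ℝ → ℝ} (hf : SatH0 T M₀ f) (t : ℝ)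
    (x : Euc N) : Differentiable ℝ (fun v => f t x v) := by
  have h := (hf.2.1 x).differentiable (by norm_num)
  exact h.comp (f := fun v : ℝ => (t, v)) (by fun_prop)

lemma f_lip {N : ℕ} {T M₀ : ℝ} {f : ℝ → Euc N → ℝ → ℝ} (hf : SatH0 T M₀ f) (R : ℝ) (hR : 0 < R) :
    ∃ L, 0 ≤ L ∧ ∀ t x p q, |p| ≤ R → |q| ≤ R →
      |q * f t x q - p * f t x p| ≤ L * |q - p| := by
  obtain ⟨C, hC⟩ := (hf.2.2.1 R hR).1
  have hC0 : 0 ≤ C := by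
    have := hC 0 0 0 (by simpa using hR.le)
    exact le_trans (by positivity) this
  refine ⟨R * C + C, by positivity, ?_⟩
  intro t x p q hp hq
  have h1 : |f t x q - f t x p| ≤ C * |q - p| := by
    have := Convex.norm_image_sub_le_of_norm_deriv_le (f := fun v => f t x v) (C := C)
      (s := Icc (-R) R) (x := p) (y := q)
      (fun v _ => (slice_diff hf t x) v)
      (fun v hv => by
        have := hC t x v (abs_le.2 hv)
        rw [Real.norm_eq_abs]
        have h1 := abs_nonneg (f t x v)
        have h2 := abs_nonneg (deriv (fun s => f s x v) t)
        linarith)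
      (convex_Icc _ _) (abs_le.1 hp) (abs_le.1 hq)
    simpa [Real.norm_eq_abs] using this
  have h2 : |f t x p| ≤ C := by
    have := hC t x p hp
    have h1 := abs_nonneg (deriv (fun v => f t x v) p)
    have h2 := abs_nonneg (deriv (fun s => f s x p) t)
    linarith
  have e : q * f t x q - p * f t x p = q * (f t x q - f t x p) + f t x p * (q - p) := by ring
  rw [e]
  refine (abs_add_le _ _).trans ?_
  rw [abs_mul, abs_mul, add_mul, mul_assoc]
  gcongr

lemma comparison_s11 {N : ℕ} {T M₀ : ℝ} {f : ℝ → Euc N → ℝ → ℝ} (hf : SatH0 T M₀ f)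
    (κ : Euc N → ℝ) (hκ : KernelHyp κ) (τ b : ℝ)
    (p q p' q' : ℝ → Euc N → ℝ)
    (hpx : ∀ t ∈ Icc 0 b, Continuous (p t)) (hqx : ∀ t ∈ Icc 0 b, Continuous (q t))
    (hpt : ∀ x, ContinuousOn (fun t => p t x) (Icc 0 b))
    (hqt : ∀ x, ContinuousOn (fun t => q t x) (Icc 0 b))
    (h0 : ∀ x, p 0 x ≤ q 0 x)
    (hp : ∀ x, ∀ t, 0 < t → t ≤ b → HasDerivAt (fun s => p s x) (p' t x) t)
    (hq : ∀ x, ∀ t, 0 < t → t ≤ b → HasDerivAt (fun s => q s x) (q' t x) t)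
    (hsub : ∀ x, ∀ t, 0 < t → t ≤ b → p' t x ≤ RHS κ (fun t x w => f (t + τ) x w) p t x)
    (hsup : ∀ x, ∀ t, 0 < t → t ≤ b → RHS κ (fun t x w => f (t + τ) x w) q t x ≤ q' t x)
    (Cp Cq : ℝ) (hbp : ∀ t ∈ Icc 0 b, ∀ x, |p t x| ≤ Cp) (hbq : ∀ t ∈ Icc 0 b, ∀ x, |q t x| ≤ Cq) :
    ∀ t ∈ Icc 0 b, ∀ x, p t x ≤ q t x := by
  obtain ⟨L, hL, hLip⟩ := f_lip hf (|Cp| + |Cq| + 1) (by positivity)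
  have key := comp_nonneg κ hκ b L hL (fun t x => q t x - p t x) (fun t x => q' t x - p' t x)
    (fun t ht => (hqx t ht).sub (hpx t ht)) (fun x => (hqt x).sub (hpt x))
    (fun x => sub_nonneg.2 (h0 x)) (fun x t h1 h2 => (hq x t h1 h2).sub (hp x t h1 h2))
    (by
      intro x t h1 h2
      have ht : t ∈ Icc 0 b := ⟨h1.le, h2⟩
      have hs1 := hsub x t h1 h2
      have hs2 := hsup x t h1 h2
      have hl := hLip (t + τ) x (p t x) (q t x)
        ((hbp t ht x).trans (by have := le_abs_self Cp; have := abs_nonneg Cq; linarith))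
        ((hbq t ht x).trans (by have := le_abs_self Cq; have := abs_nonneg Cp; linarith))
      have hl2 := neg_le_of_abs_le hl
      have hint : ∫ y, κ (y - x) * (q t y - p t y) =
          (∫ y, κ (y - x) * q t y) - ∫ y, κ (y - x) * p t y := by
        rw [← integral_sub (kernel_int κ hκ _ (hqx t ht) x) (kernel_int κ hκ _ (hpx t ht) x)]
        congr 1; ext y; ring
      rw [hint]
      unfold RHS at hs1 hs2
      linarith)
    (Cp + Cq)
    (fun t ht x => (abs_sub _ _).trans (by have := hbp t ht x; have := hbq t ht x; linarith))
  intro t ht x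
  exact sub_nonneg.1 (key t ht x)

lemma f_mono {N : ℕ} {T M₀ : ℝ} {f : ℝ → Euc N → ℝ → ℝ} (hf : SatH0 T M₀ f) (R : ℝ) (hR : 0 ≤ R) :
    ∃ c > 0, ∀ t x p q, 0 ≤ p → p ≤ q → q ≤ R → c * (q - p) ≤ f t x p - f t x q := by
  obtain ⟨c, hc, h⟩ := hf.2.2.2.2 0 R le_rfl hR
  refine ⟨-c, by linarith, ?_⟩
  intro t x p q hp hpq hq
  have := Convex.image_sub_le_mul_sub_of_deriv_le (convex_Icc 0 R) (f := fun v => f t x v) (C := c)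
    (slice_diff hf t x).continuous.continuousOn (slice_diff hf t x).differentiableOn
    (fun v hv => h t x v (interior_subset hv).1 (interior_subset hv).2)
    p ⟨hp, hpq.trans hq⟩ q ⟨hp.trans hpq, hq⟩ hpq
  try dsimp only at this
  linarith

/-- asymptotic stability of the time periodic strictly positive
solution, uniformly over time shifts. -/
theorem stmt11 {N : ℕ} (hN : 1 ≤ N) (T M₀ : ℝ) (hT : 0 < T) (hM₀ : 0 < M₀)
    (κ : Euc N → ℝ) (hκ : KernelHyp κ)
    (f : ℝ → Euc N → ℝ → ℝ) (hf : SatH0 T M₀ f)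
    (ustar : ℝ → Euc N → ℝ) (hstar : PeriodicPosSol κ f T ustar)
    (u₀ : Euc N → ℝ) (hu₀ : MemX u₀) (hpos : ∃ δ > 0, ∀ x, δ ≤ u₀ x)
    (ε : ℝ) (hε : 0 < ε) :
    ∃ t₀ > (0:ℝ), ∀ τ : ℝ, ∀ v : ℝ → Euc N → ℝ,
      IsSol κ (fun t x w => f (t + τ) x w) v (Set.Ici 0) → (∀ x, v 0 x = u₀ x) →
      ∀ t ≥ t₀, ∀ x, |v t x - ustar (t + τ) x| ≤ ε := by
  obtain ⟨⟨hsc, hsX, hsB, hsD⟩, hper, δ, hδ, hδs⟩ := hstar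
  obtain ⟨δ₀, hδ₀, hδu⟩ := hpos
  obtain ⟨hu₀c, C₀, hC₀⟩ := hu₀
  -- global bound of ustar
  obtain ⟨Cw, hCw⟩ : ∃ C, ∀ t x, ustar t x ≤ C := by
    obtain ⟨C, hC⟩ := hsB (Icc 0 T) (subset_univ _) isCompact_Icc
    refine ⟨C, fun t x => ?_⟩
    have hp : Function.Periodic (fun t => ustar t x) T := fun t => hper t x
    obtain ⟨s, hs, hse⟩ := hp.exists_mem_Ico₀ hT t
    try dsimp only at hse
    rw [hse]
    exact (le_abs_self _).trans (hC s ⟨hs.1, hs.2.le⟩ x)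
  have hCw0 : 0 < Cw := hδ.trans_le ((hδs 0 0).trans (hCw 0 0))
  have hC00 : 0 ≤ C₀ := (abs_nonneg _).trans (hC₀ 0)
  set A : ℝ := C₀ / δ with hA
  have hA0 : 0 ≤ A := by positivity
  set β : ℝ := min (1/2) (δ₀ / Cw) with hβ
  have hβ0 : 0 < β := lt_min (by norm_num) (by positivity)
  have hβ1 : β ≤ 1/2 := min_le_left _ _
  have hβ2 : β * Cw ≤ δ₀ := by
    have : β ≤ δ₀ / Cw := min_le_right _ _
    rwa [le_div_iff₀ hCw0] at this
  obtain ⟨c, hc, hfm⟩ := f_mono hf ((1 + A) * Cw) (by positivity)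
  set lam : ℝ := β * (c * δ) with hlam
  have hcd : 0 < c * δ := by positivity
  have hlam0 : 0 < lam := by positivity
  have hlam1 : lam ≤ c * δ := by nlinarith
  -- the decay time
  have hlim : Tendsto (fun t : ℝ => (A + 1) * Cw * Real.exp (-(lam * t))) atTop
      (nhds ((A + 1) * Cw * 0)) := by
    apply Tendsto.const_mul
    exact Real.tendsto_exp_neg_atTop_nhds_zero.comp (tendsto_id.const_mul_atTop hlam0)
  rw [mul_zero] at hlim
  obtain ⟨t₁, ht₁⟩ := (hlim.eventually (gt_mem_nhds hε)).exists_forall_of_atTop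
  refine ⟨max t₁ 1, lt_of_lt_of_le one_pos (le_max_right _ _), ?_⟩
  intro τ v hv hv0 t ht x
  have htt₁ : t₁ ≤ t := (le_max_left _ _).trans ht
  have ht0 : 0 < t := lt_of_lt_of_le one_pos ((le_max_right _ _).trans ht)
  obtain ⟨hvc, hvX, hvB, hvD⟩ := hv
  set w : ℝ → Euc N → ℝ := fun s y => ustar (s + τ) y with hw
  have hwx : ∀ s, Continuous (w s) := fun s => (hsX (s + τ) (mem_univ _)).1.continuous
  have hwD : ∀ s y, HasDerivAt (fun s => w s y) (RHS κ (fun t x w => f (t + τ) x w) w s y) s := by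
    intro s y
    have h1 := hsD y (s + τ) (by simp)
    have := h1.comp_add_const s τ
    exact this
  have hwl : ∀ s y, δ ≤ w s y := fun s y => hδs _ _
  have hwu : ∀ s y, w s y ≤ Cw := fun s y => hCw _ _
  have hvx : ∀ s ∈ Icc 0 t, Continuous (v s) := fun s hs => (hvX s hs.1).1.continuous
  have hvt : ∀ y, ContinuousOn (fun s => v s y) (Icc 0 t) := by
    intro y
    exact hvc.comp (f := fun s : ℝ => (s, y)) (by fun_prop) (fun s hs => ⟨hs.1, mem_univ _⟩)
  have hvd : ∀ y, ∀ s, 0 < s → s ≤ t →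
      HasDerivAt (fun s => v s y) (RHS κ (fun t x w => f (t + τ) x w) v s y) s := by
    intro y s hs _
    exact hvD y s (by rw [interior_Ici]; exact hs)
  obtain ⟨Cv, hCv⟩ := hvB (Icc 0 t) (fun s hs => hs.1) isCompact_Icc
  -- the multiplicative barriers
  have hgd : ∀ a s : ℝ, HasDerivAt (fun s => 1 + a * Real.exp (-(lam * s)))
      (-(lam * (a * Real.exp (-(lam * s))))) s := by
    intro a s
    have h1 : HasDerivAt (fun s : ℝ => -(lam * s)) (-lam) s := by
      simpa using ((hasDerivAt_id s).const_mul lam).fun_neg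
    have h2 := ((h1.exp).const_mul a).const_add 1
    refine h2.congr_deriv ?_
    ring
  have hbd : ∀ a s y, HasDerivAt (fun s => (1 + a * Real.exp (-(lam * s))) * w s y)
      (-(lam * (a * Real.exp (-(lam * s)))) * w s y + (1 + a * Real.exp (-(lam * s))) *
        RHS κ (fun t x w => f (t + τ) x w) w s y) s := fun a s y => (hgd a s).mul (hwD s y)
  have hbt : ∀ a y, ContinuousOn (fun s => (1 + a * Real.exp (-(lam * s))) * w s y) (Icc 0 t) :=
    fun a y s _ => (hbd a s y).continuousAt.continuousWithinAt
  have hR : ∀ (g : ℝ → ℝ) s y, RHS κ (fun t x w => f (t + τ) x w) (fun s y => g s * w s y) s y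
      = g s * RHS κ (fun t x w => f (t + τ) x w) w s y
        - g s * w s y * (f (s + τ) y (w s y) - f (s + τ) y (g s * w s y)) := by
    intro g s y
    have : ∫ z, κ (z - y) * (g s * w s z) = g s * ∫ z, κ (z - y) * w s z := by
      rw [← integral_const_mul]
      congr 1; ext z; ring
    unfold RHS
    rw [this]
    ring
  have hexp : ∀ s : ℝ, 0 ≤ s → Real.exp (-(lam * s)) ≤ 1 := fun s hs => by
    rw [Real.exp_le_one_iff]
    have : 0 ≤ lam * s := by positivity
    linarith
  have hbb : ∀ a : ℝ, ∀ s ∈ Icc 0 t, ∀ y,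
      |(1 + a * Real.exp (-(lam * s))) * w s y| ≤ (1 + |a|) * Cw := by
    intro a s hs y
    rw [abs_mul]
    have h1 : |w s y| ≤ Cw := by
      rw [abs_of_pos (hδ.trans_le (hwl s y))]; exact hwu s y
    have h2 : |1 + a * Real.exp (-(lam * s))| ≤ 1 + |a| := by
      refine (abs_add_le _ _).trans ?_
      rw [abs_one, abs_mul, abs_of_pos (Real.exp_pos _)]
      have := mul_le_mul_of_nonneg_left (hexp s hs.1) (abs_nonneg a)
      linarith
    exact mul_le_mul h2 h1 (abs_nonneg _) (by positivity)
  -- upper comparison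
  have hup : v t x ≤ (1 + A * Real.exp (-(lam * t))) * w t x := by
    refine comparison_s11 hf κ hκ τ t v (fun s y => (1 + A * Real.exp (-(lam * s))) * w s y) _ _
      hvx (fun s _ => (hwx s).const_mul _) hvt (hbt A) ?_ hvd (fun y s _ _ => hbd A s y)
      (fun _ _ _ _ => le_rfl) ?_ Cv _ hCv (hbb A) t ⟨ht0.le, le_rfl⟩ x
    · intro y
      simp only [mul_zero, neg_zero, Real.exp_zero, mul_one]
      rw [hv0]
      have h1 : A * δ = C₀ := by rw [hA]; field_simp
      have h2 := (le_abs_self _).trans (hC₀ y)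
      have h3 := hwl 0 y
      have h4 : A * δ ≤ A * w 0 y := mul_le_mul_of_nonneg_left h3 hA0
      linarith
    · intro y s hs hst
      rw [hR (fun s => 1 + A * Real.exp (-(lam * s)))]
      have he := hexp s hs.le
      have he0 := Real.exp_pos (-(lam * s))
      set E := A * Real.exp (-(lam * s)) with hE
      have hE0 : 0 ≤ E := by positivity
      have hE1 : E ≤ A := by nlinarith
      have hwp := hwl s y
      have hwp0 : 0 < w s y := hδ.trans_le hwp
      have hm := hfm (s + τ) y (w s y) ((1 + E) * w s y) hwp0.le (by nlinarith)
        (mul_le_mul (by linarith) (hwu s y) hwp0.le (by positivity))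
      have h1 : lam * E ≤ c * ((1 + E) * w s y - w s y) := by
        have : c * δ * E ≤ c * w s y * E := by gcongr
        have := mul_le_mul_of_nonneg_right hlam1 hE0
        linarith
      set D := f (s + τ) y (w s y) - f (s + τ) y ((1 + E) * w s y) with hD
      have h2 : lam * E ≤ D := h1.trans hm
      have h20 : 0 ≤ lam * E := by positivity
      have h3 : lam * E ≤ (1 + E) * D := by nlinarith
      have h4 := mul_le_mul_of_nonneg_left h3 hwp0.le
      try dsimp only
      linarith
  have hlo : (1 + (-(1 - β)) * Real.exp (-(lam * t))) * w t x ≤ v t x := by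
    refine comparison_s11 hf κ hκ τ t (fun s y => (1 + (-(1 - β)) * Real.exp (-(lam * s))) * w s y) v _ _
      (fun s _ => (hwx s).const_mul _) hvx (hbt _) hvt ?_ (fun y s _ _ => hbd _ s y) hvd
      ?_ (fun _ _ _ _ => le_rfl) _ Cv (hbb _) hCv t ⟨ht0.le, le_rfl⟩ x
    · intro y
      simp only [mul_zero, neg_zero, Real.exp_zero, mul_one]
      rw [hv0]
      have h2 := hδu y
      have h4 : β * w 0 y ≤ β * Cw := mul_le_mul_of_nonneg_left (hwu 0 y) hβ0.le
      linarith
    · intro y s hs hst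
      rw [hR (fun s => 1 + (-(1 - β)) * Real.exp (-(lam * s)))]
      have he := hexp s hs.le
      have he0 := Real.exp_pos (-(lam * s))
      obtain ⟨E, hE⟩ : ∃ E, E = (1 - β) * Real.exp (-(lam * s)) := ⟨_, rfl⟩
      have hEE : -(1 - β) * Real.exp (-(lam * s)) = -E := by rw [hE]; ring
      have hE0 : 0 ≤ E := by rw [hE]; exact mul_nonneg (by linarith) he0.le
      have hE1 : E ≤ 1 - β := by nlinarith
      have hwp := hwl s y
      have hwp0 : 0 < w s y := hδ.trans_le hwp
      have hm := hfm (s + τ) y ((1 + -E) * w s y) (w s y)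
        (mul_nonneg (by linarith) hwp0.le) (by nlinarith)
        (by have := hwu s y; nlinarith)
      try dsimp only
      rw [hEE]
      obtain ⟨D, hD⟩ : ∃ D, D = f (s + τ) y (w s y) - f (s + τ) y ((1 + -E) * w s y) := ⟨_, rfl⟩
      rw [← hD]
      have h1 : c * δ * E ≤ -D := by
        have : c * δ * E ≤ c * w s y * E := by gcongr
        linarith
      have h0' : 0 ≤ c * δ * E := by positivity
      have h3 : lam * E ≤ (1 + -E) * (-D) := by
        have e1 : lam * E = β * (c * δ * E) := by rw [hlam]; ring
        rw [e1]
        exact mul_le_mul (by linarith) h1 h0' (by linarith)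
      have h4 := mul_le_mul_of_nonneg_left h3 hwp0.le
      linarith
  have hfin := (ht₁ t htt₁).le
  have hep := Real.exp_pos (-(lam * t))
  have hwt0 : 0 ≤ w t x := hδ.le.trans (hwl t x)
  have hk : ∀ a, 0 ≤ a → a ≤ A + 1 → a * Real.exp (-(lam * t)) * w t x ≤ ε := by
    intro a ha ha1
    refine le_trans ?_ hfin
    have h1 := hwu t x
    calc a * Real.exp (-(lam * t)) * w t x ≤ (A + 1) * Real.exp (-(lam * t)) * Cw := by gcongr
      _ = _ := by ring
  have k1 := hk A hA0 (by linarith)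
  have k2 := hk (1 - β) (by linarith) (by linarith)
  change |v t x - w t x| ≤ ε
  rw [abs_le]
  constructor <;> linarith

end
end
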